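/- arXiv:2109.00305 — 3 statements merged into one kernel-verified Lean document; each statement's English description precedes it below -/
import Mathlib

section
/- Let A be an idempotent-complete additive category and K^b(A) its bounded homotopy category of chain complexes. Define K^b(A)^{w≥0} to be the full subcategory of objects isomorphic in K^b(A) to a complex X with X_i = 0 for all i < 0, and K^b(A)^{w≤0} the full subcategory of objects isomorphic to a complex X with X_i = 0 for all i > 0. Then (K^b(A)^{w≤0}, K^b(A)^{w≥0}) is a bounded weight structure on K^b(A), and its heart K^b(A)^{w=0} is equivalent to A (via the embedding of A as complexes concentrated in degree 0). -/
/-!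
STATEMENT 1: For an idempotent-complete additive category `A`, the pair
`(K^b(A)^{w≤0}, K^b(A)^{w≥0})` given by the subcategories of objects isomorphic to
complexes concentrated in non-positive (resp. non-negative) degrees is a bounded
weight structure on the bounded homotopy category `K^b(A)`, with heart equivalent
to `A` via the degree-`0` embedding.

We realise `K^b(A)` as the (strictly full, isomorphism-closed) subcategory of bounded
objects inside the homotopy category `K(A)` of unbounded complexes, and spell out all
the axioms of a bounded weight structure together with the identification of the heart.
-/

open CategoryTheory Limits Pretriangulated

universe v u

variable (A : Type u) [Category.{v} A] [Preadditive A] [HasZeroObject A]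
  [HasBinaryBiproducts A]

/-- objects of `K(A)` isomorphic to a bounded complex, i.e. the objects of `K^b(A)` -/
def KbObj : Set (HomotopyCategory A (ComplexShape.up ℤ)) :=
  {X | ∃ Y : CochainComplex A ℤ,
    (∃ a : ℤ, ∀ i < a, IsZero (Y.X i)) ∧ (∃ b : ℤ, ∀ i > b, IsZero (Y.X i)) ∧
    Nonempty (X ≅ (HomotopyCategory.quotient A (ComplexShape.up ℤ)).obj Y)}

/-- `K^b(A)^{w≤0}`: objects isomorphic in `K^b(A)` to a bounded complex concentrated in
degrees `≤ 0` -/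
def KbLE : Set (HomotopyCategory A (ComplexShape.up ℤ)) :=
  {X | ∃ Y : CochainComplex A ℤ,
    (∃ a : ℤ, ∀ i < a, IsZero (Y.X i)) ∧ (∀ i > (0 : ℤ), IsZero (Y.X i)) ∧
    Nonempty (X ≅ (HomotopyCategory.quotient A (ComplexShape.up ℤ)).obj Y)}

/-- `K^b(A)^{w≥0}`: objects isomorphic in `K^b(A)` to a bounded complex concentrated in
degrees `≥ 0` -/
def KbGE : Set (HomotopyCategory A (ComplexShape.up ℤ)) :=
  {X | ∃ Y : CochainComplex A ℤ,
    (∀ i < (0 : ℤ), IsZero (Y.X i)) ∧ (∃ b : ℤ, ∀ i > b, IsZero (Y.X i)) ∧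
    Nonempty (X ≅ (HomotopyCategory.quotient A (ComplexShape.up ℤ)).obj Y)}

/-- the embedding of `A` into `K^b(A)` as complexes concentrated in degree `0` -/
noncomputable def degreeZeroEmbedding : A ⥤ HomotopyCategory A (ComplexShape.up ℤ) :=
  HomologicalComplex.single A (ComplexShape.up ℤ) 0 ⋙
    HomotopyCategory.quotient A (ComplexShape.up ℤ)

section

variable {A}

/-- An object which is a retract of `X` in a category with zero morphisms is zero as soon as the
associated idempotent of `X` vanishes. -/
lemma isZero_of_retract_of_comp_eq_zero {C : Type*} [Category C] [HasZeroMorphisms C] {X Y : C}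
    (i : Y ⟶ X) (r : X ⟶ Y) (hir : i ≫ r = 𝟙 Y) (hri : r ≫ i = 0) : IsZero Y := by
  rw [IsZero.iff_id_eq_zero, ← Category.comp_id (𝟙 Y), ← hir, Category.assoc, reassoc_of% hri]
  simp

omit [HasZeroObject A] [HasBinaryBiproducts A] in
/-- Up to homotopy equivalence, a complex which is contractible in the degrees outside `[a, b]`
can be replaced by a degreewise retract of it which vanishes outside `[a, b]`. -/
lemma exists_iso_quotient_of_contractible_outside [IsIdempotentComplete A]
    (Y : CochainComplex A ℤ) (a b : ℤ) (hab : a < b) (h : ∀ i j : ℤ, Y.X i ⟶ Y.X j)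
    (hh : ∀ i j k : ℤ, i + 1 = j → j + 1 = k → (j < a ∨ b < j) →
      Y.d j k ≫ h k j + h j i ≫ Y.d i j = 𝟙 (Y.X j)) :
    ∃ Z : CochainComplex A ℤ, (∀ i, (i < a ∨ b < i) → IsZero (Z.X i)) ∧
      (∀ i, IsZero (Y.X i) → IsZero (Z.X i)) ∧
      Nonempty ((HomotopyCategory.quotient A (ComplexShape.up ℤ)).obj Y ≅
        (HomotopyCategory.quotient A (ComplexShape.up ℤ)).obj Z) := by
  classical
  let h' : ∀ i j : ℤ, Y.X i ⟶ Y.X j := fun i j =>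
    if j + 1 = i ∧ (j < a ∨ b < i) then h i j else 0
  have h'_zero : ∀ i j, ¬ (ComplexShape.up ℤ).Rel j i → h' i j = 0 := fun i j hij =>
    if_neg (fun H => hij H.1)
  let N := Homotopy.nullHomotopicMap (C := Y) (D := Y) h'
  have hN : ∀ i j k : ℤ, i + 1 = j → j + 1 = k →
      N.f j = Y.d j k ≫ h' k j + h' j i ≫ Y.d i j := fun i j k hij hjk =>
    Homotopy.nullHomotopicMap_f (c := ComplexShape.up ℤ) hij hjk h'
  have hN_outside : ∀ j, (j < a ∨ b < j) → N.f j = 𝟙 _ := by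
    intro j hj
    rw [hN (j - 1) j (j + 1) (by lia) rfl, ← hh (j - 1) j (j + 1) (by lia) rfl hj]
    dsimp only [h']
    rw [if_pos (by lia), if_pos (by lia)]
  have hN_idem : N ≫ N = N := by
    ext j
    rw [HomologicalComplex.comp_f]
    by_cases hj : j < a ∨ b < j
    · rw [hN_outside j hj, Category.comp_id]
    · rw [hN (j - 1) j (j + 1) (by lia) rfl]
      dsimp only [h']
      by_cases hja : j = a
      · have e := hh (j - 2) (j - 1) j (by lia) (by lia) (by lia)
        have e' : Y.d (j - 1) j ≫ h j (j - 1) ≫ Y.d (j - 1) j = Y.d (j - 1) j := by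
          simpa using e =≫ Y.d (j - 1) j
        rw [if_neg (by lia), if_pos (by lia)]
        simp [e']
      · by_cases hjb : j = b
        · have e := hh j (j + 1) (j + 2) (by lia) (by lia) (by lia)
          have e' : Y.d j (j + 1) ≫ h (j + 1) j ≫ Y.d j (j + 1) = Y.d j (j + 1) := by
            simpa using Y.d j (j + 1) ≫= e
          rw [if_pos (by lia), if_neg (by lia)]
          simp [reassoc_of% e']
        · rw [if_neg (by lia), if_neg (by lia)]
          simp
  obtain ⟨Z, i, p, hip, hpi⟩ := IsIdempotentComplete.idempotents_split Y (𝟙 Y - N) (by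
    simp [hN_idem])
  refine ⟨Z, fun n hn => ?_, fun n hn => ?_, ⟨?_⟩⟩
  · refine isZero_of_retract_of_comp_eq_zero (i.f n) (p.f n) ?_ ?_
    · rw [← HomologicalComplex.comp_f, hip, HomologicalComplex.id_f]
    · rw [← HomologicalComplex.comp_f, hpi, HomologicalComplex.sub_f_apply,
        HomologicalComplex.id_f, hN_outside n hn, sub_self]
  · refine isZero_of_retract_of_comp_eq_zero (i.f n) (p.f n) ?_ (hn.eq_of_src _ _)
    rw [← HomologicalComplex.comp_f, hip, HomologicalComplex.id_f]
  · have hN_zero : (HomotopyCategory.quotient A (ComplexShape.up ℤ)).map N = 0 := by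
      rw [HomotopyCategory.eq_of_homotopy _ _ (Homotopy.nullHomotopy h' h'_zero), Functor.map_zero]
    exact
      { hom := (HomotopyCategory.quotient A (ComplexShape.up ℤ)).map p
        inv := (HomotopyCategory.quotient A (ComplexShape.up ℤ)).map i
        hom_inv_id := by
          rw [← Functor.map_comp, hpi, Functor.map_sub, hN_zero, sub_zero,
            CategoryTheory.Functor.map_id]
        inv_hom_id := by rw [← Functor.map_comp, hip, CategoryTheory.Functor.map_id] }

omit [HasZeroObject A] [HasBinaryBiproducts A] in
/-- If the image of `Y` in the homotopy category is a retract of the image of a complex `X` which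
vanishes outside `[a, b]`, then up to homotopy equivalence `Y` can be replaced by a
degreewise retract of it which vanishes outside `[a, b]`. -/
lemma exists_iso_quotient_of_retract [IsIdempotentComplete A] (X Y : CochainComplex A ℤ)
    (i : (HomotopyCategory.quotient A (ComplexShape.up ℤ)).obj Y ⟶
      (HomotopyCategory.quotient A (ComplexShape.up ℤ)).obj X)
    (r : (HomotopyCategory.quotient A (ComplexShape.up ℤ)).obj X ⟶
      (HomotopyCategory.quotient A (ComplexShape.up ℤ)).obj Y)
    (hir : i ≫ r = 𝟙 _) (a b : ℤ) (hab : a < b)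
    (hX : ∀ n, (n < a ∨ b < n) → IsZero (X.X n)) :
    ∃ Z : CochainComplex A ℤ, (∀ i, (i < a ∨ b < i) → IsZero (Z.X i)) ∧
      (∀ i, IsZero (Y.X i) → IsZero (Z.X i)) ∧
      Nonempty ((HomotopyCategory.quotient A (ComplexShape.up ℤ)).obj Y ≅
        (HomotopyCategory.quotient A (ComplexShape.up ℤ)).obj Z) := by
  obtain ⟨i, rfl⟩ := (HomotopyCategory.quotient A (ComplexShape.up ℤ)).map_surjective i
  obtain ⟨r, rfl⟩ := (HomotopyCategory.quotient A (ComplexShape.up ℤ)).map_surjective r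
  rw [← Functor.map_comp, ← CategoryTheory.Functor.map_id] at hir
  let H : Homotopy (𝟙 Y) (i ≫ r) := HomotopyCategory.homotopyOfEq _ _ hir.symm
  refine exists_iso_quotient_of_contractible_outside Y a b hab H.hom ?_
  intro l j k hlj hjk hj
  have hcomm := H.comm j
  rw [dNext_eq H.hom (show (ComplexShape.up ℤ).Rel j k from hjk),
    prevD_eq H.hom (show (ComplexShape.up ℤ).Rel l j from hlj), HomologicalComplex.comp_f,
    (hX j hj).eq_of_tgt (i.f j) 0, zero_comp, add_zero, HomologicalComplex.id_f] at hcomm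
  exact hcomm.symm

omit [HasBinaryBiproducts A] in
/-- Brutal truncation: if `q` is a set of degrees which is closed under successor, then any
complex `Y` is the middle term of a degreewise split short exact sequence `P ⟶ Y ⟶ Q`,
where `P` is supported in the degrees in `q`, and `Q` in the other degrees. -/
lemma exists_degreewise_splitting (Y : CochainComplex A ℤ) (q : ℤ → Prop)
    (hq : ∀ n, q n → q (n + 1)) :
    ∃ (S : ShortComplex (CochainComplex A ℤ)) (_ : S.X₂ = Y),
      Nonempty (∀ n, (S.map (HomologicalComplex.eval A _ n)).Splitting) ∧
      (∀ n, (¬ q n ∨ IsZero (Y.X n)) → IsZero (S.X₁.X n)) ∧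
      (∀ n, (q n ∨ IsZero (Y.X n)) → IsZero (S.X₃.X n)) := by
  classical
  have retract (q : ℤ → Prop) (n : ℤ) : ∃ (P : A) (i : P ⟶ Y.X n) (p : Y.X n ⟶ P),
      i ≫ p = 𝟙 P ∧ p ≫ i = if q n then 𝟙 _ else 0 := by
    by_cases hn : q n
    · exact ⟨Y.X n, 𝟙 _, 𝟙 _, by simp, by simp [hn]⟩
    · obtain ⟨Z, hZ⟩ := HasZeroObject.zero (C := A)
      exact ⟨Z, 0, 0, hZ.eq_of_src _ _, by simp [hn]⟩
  choose P i p hip hpi using retract q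
  choose Q j s hjs hsj using retract (fun n => ¬ q n)
  let KP : CochainComplex A ℤ :=
    { X := P
      d m n := i m ≫ Y.d m n ≫ p n
      shape m n hmn := by simp [Y.shape m n hmn]
      d_comp_d' k m n _ _ := by
        simp only [Category.assoc, reassoc_of% hpi]
        split_ifs <;> simp }
  let KQ : CochainComplex A ℤ :=
    { X := Q
      d m n := j m ≫ Y.d m n ≫ s n
      shape m n hmn := by simp [Y.shape m n hmn]
      d_comp_d' k m n _ _ := by
        simp only [Category.assoc, reassoc_of% hsj]
        split_ifs <;> simp }
  have i_eq_zero (n : ℤ) (hn : ¬ q n) : i n = 0 := by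
    rw [← Category.id_comp (i n), ← hip, Category.assoc, hpi, if_neg hn, comp_zero]
  have s_eq_zero (n : ℤ) (hn : q n) : s n = 0 := by
    rw [← Category.comp_id (s n), ← hjs, reassoc_of% hsj, if_neg (not_not.2 hn), zero_comp]
  let f : KP ⟶ Y :=
    { f := i
      comm' := by
        rintro m _ rfl
        by_cases hm : q m
        · simp [KP, hpi, hq m hm]
        · simp [KP, i_eq_zero m hm] }
  let g : Y ⟶ KQ :=
    { f := s
      comm' := by
        rintro m _ rfl
        by_cases hm : q m
        · simp [KQ, s_eq_zero _ (hq m hm)]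
        · simp [KQ, reassoc_of% hsj, hm] }
  have hfg : f ≫ g = 0 := by
    ext n
    by_cases hn : q n
    · simp [f, g, s_eq_zero n hn]
    · simp [f, g, i_eq_zero n hn]
  refine ⟨ShortComplex.mk f g hfg, rfl, ⟨fun n =>
    { r := p n
      s := j n
      f_r := hip n
      s_g := hjs n
      id := ?_ }⟩, ?_, ?_⟩
  · change p n ≫ i n + s n ≫ j n = 𝟙 _
    rw [hpi, hsj]
    by_cases hn : q n <;> simp [hn]
  · rintro n (hn | hn)
    · exact isZero_of_retract_of_comp_eq_zero (i n) (p n) (hip n) (by rw [hpi, if_neg hn])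
    · exact isZero_of_retract_of_comp_eq_zero (i n) (p n) (hip n) (hn.eq_of_src _ _)
  · rintro n (hn | hn)
    · exact isZero_of_retract_of_comp_eq_zero (j n) (s n) (hjs n)
        (by rw [hsj, if_neg (not_not.2 hn)])
    · exact isZero_of_retract_of_comp_eq_zero (j n) (s n) (hjs n) (hn.eq_of_src _ _)

/-- A shift of an object represented by a complex `Y` is represented by the shifted complex. -/
noncomputable def shiftIsoQuotientShift {X : HomotopyCategory A (ComplexShape.up ℤ)}
    {Y : CochainComplex A ℤ} (e : X ≅ (HomotopyCategory.quotient A (ComplexShape.up ℤ)).obj Y)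
    (n : ℤ) : X⟦n⟧ ≅ (HomotopyCategory.quotient A (ComplexShape.up ℤ)).obj (Y⟦n⟧) :=
  (shiftFunctor _ n).mapIso e ≪≫
    (((HomotopyCategory.quotient A (ComplexShape.up ℤ)).commShiftIso n).app Y).symm

omit [HasBinaryBiproducts A] in
/-- A complex concentrated in degree `0` is isomorphic to a complex `single`. -/
lemma nonempty_iso_single_of_isZero (Y : CochainComplex A ℤ)
    (hY : ∀ n : ℤ, n ≠ 0 → IsZero (Y.X n)) :
    Nonempty (Y ≅ (HomologicalComplex.single A (ComplexShape.up ℤ) 0).obj (Y.X 0)) := by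
  refine ⟨HomologicalComplex.Hom.isoOfComponents (fun n =>
    if hn : n = 0 then by
      subst hn
      exact (HomologicalComplex.singleObjXSelf (ComplexShape.up ℤ) 0 (Y.X 0)).symm
    else (hY n hn).iso (HomologicalComplex.isZero_single_obj_X _ 0 _ n hn)) ?_⟩
  rintro m _ rfl
  by_cases hm : m = 0
  · exact (HomologicalComplex.isZero_single_obj_X _ 0 _ _ (by lia)).eq_of_tgt _ _
  · exact (hY m hm).eq_of_src _ _

omit [HasZeroObject A] [HasBinaryBiproducts A] in
lemma kbLE_of_retract [IsIdempotentComplete A]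
    {X Y : HomotopyCategory A (ComplexShape.up ℤ)} (i : Y ⟶ X) (r : X ⟶ Y)
    (hir : i ≫ r = 𝟙 Y) (hX : X ∈ KbLE A) : Y ∈ KbLE A := by
  obtain ⟨X', ⟨a, ha⟩, hX', ⟨e⟩⟩ := hX
  obtain ⟨Y, rfl⟩ := HomotopyCategory.quotient_obj_surjective Y
  obtain ⟨Z, hZ, -, ⟨e'⟩⟩ := exists_iso_quotient_of_retract X' Y (i ≫ e.hom) (e.inv ≫ r)
    (by simpa using hir) (min a (-1)) 0 (by lia) (by
      rintro n (hn | hn)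
      · exact ha n (by lia)
      · exact hX' n hn)
  exact ⟨Z, ⟨min a (-1), fun n hn => hZ n (.inl hn)⟩, fun n hn => hZ n (.inr hn), ⟨e'⟩⟩

omit [HasZeroObject A] [HasBinaryBiproducts A] in
lemma kbGE_of_retract [IsIdempotentComplete A]
    {X Y : HomotopyCategory A (ComplexShape.up ℤ)} (i : Y ⟶ X) (r : X ⟶ Y)
    (hir : i ≫ r = 𝟙 Y) (hX : X ∈ KbGE A) : Y ∈ KbGE A := by
  obtain ⟨X', hX', ⟨b, hb⟩, ⟨e⟩⟩ := hX
  obtain ⟨Y, rfl⟩ := HomotopyCategory.quotient_obj_surjective Y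
  obtain ⟨Z, hZ, -, ⟨e'⟩⟩ := exists_iso_quotient_of_retract X' Y (i ≫ e.hom) (e.inv ≫ r)
    (by simpa using hir) 0 (max b 1) (by lia) (by
      rintro n (hn | hn)
      · exact hX' n hn
      · exact hb n (by lia))
  exact ⟨Z, fun n hn => hZ n (.inl hn), ⟨max b 1, fun n hn => hZ n (.inr hn)⟩, ⟨e'⟩⟩

omit [HasZeroObject A] [HasBinaryBiproducts A] in
lemma eq_zero_of_kbGE_of_kbLE {X Y : HomotopyCategory A (ComplexShape.up ℤ)}
    (hX : X ∈ KbGE A) (hY : Y⟦(-1 : ℤ)⟧ ∈ KbLE A) (f : X ⟶ Y) : f = 0 := by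
  obtain ⟨X', hX', -, ⟨e⟩⟩ := hX
  obtain ⟨Y', -, hY', ⟨e'⟩⟩ := hY
  let e'' : Y ≅ (HomotopyCategory.quotient A (ComplexShape.up ℤ)).obj (Y'⟦(1 : ℤ)⟧) :=
    (shiftNegShift Y (1 : ℤ)).symm ≪≫ shiftIsoQuotientShift e' 1
  obtain ⟨φ, hφ⟩ := (HomotopyCategory.quotient A (ComplexShape.up ℤ)).map_surjective
    (e.inv ≫ f ≫ e''.hom)
  have hφ_zero : φ = 0 := by
    ext n
    by_cases hn : n < 0
    · exact (hX' n hn).eq_of_src _ _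
    · exact IsZero.eq_of_tgt (hY' (n + 1) (by lia)) _ _
  rw [hφ_zero, Functor.map_zero] at hφ
  rw [← cancel_epi e.inv, ← cancel_mono e''.hom, Category.assoc, ← hφ, comp_zero, zero_comp]

lemma exists_weight_decomposition (X : HomotopyCategory A (ComplexShape.up ℤ)) (hX : X ∈ KbObj A) :
    ∃ (P Q : HomotopyCategory A (ComplexShape.up ℤ))
      (f : P ⟶ X) (g : X ⟶ Q) (h : Q ⟶ P⟦(1 : ℤ)⟧),
      (Triangle.mk f g h ∈ distTriang (HomotopyCategory A (ComplexShape.up ℤ))) ∧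
        P⟦(1 : ℤ)⟧ ∈ KbGE A ∧ Q ∈ KbLE A := by
  obtain ⟨Y, ⟨a, ha⟩, ⟨b, hb⟩, ⟨e⟩⟩ := hX
  obtain ⟨S, rfl, ⟨σ⟩, h₁, h₃⟩ := exists_degreewise_splitting Y (fun n => 1 ≤ n) (by lia)
  let T := CochainComplex.trianglehOfDegreewiseSplit S σ
  let e' : X ≅ T.obj₂ := e
  refine ⟨T.obj₁, T.obj₃, T.mor₁ ≫ e'.inv, e'.hom ≫ T.mor₂, T.mor₃, ?_, ?_, ?_⟩
  · rw [HomotopyCategory.distinguished_iff_iso_trianglehOfDegreewiseSplit]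
    refine ⟨S, σ, ⟨Triangle.isoMk _ T (Iso.refl _) e' (Iso.refl _) ?_ ?_ ?_⟩⟩
    · change (T.mor₁ ≫ e'.inv) ≫ e'.hom = 𝟙 T.obj₁ ≫ T.mor₁
      simp
    · change (e'.hom ≫ T.mor₂) ≫ 𝟙 T.obj₃ = e'.hom ≫ T.mor₂
      simp
    · change T.mor₃ ≫ (𝟙 T.obj₁)⟦(1 : ℤ)⟧' = 𝟙 T.obj₃ ≫ T.mor₃
      simp
  · exact ⟨S.X₁⟦(1 : ℤ)⟧, fun n hn => h₁ (n + 1) (.inl (by lia)),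
      ⟨b, fun n hn => h₁ (n + 1) (.inr (hb _ (by lia)))⟩, ⟨shiftIsoQuotientShift (Iso.refl _) 1⟩⟩
  · exact ⟨S.X₃, ⟨a, fun n hn => h₃ n (.inr (ha n hn))⟩, fun n hn => h₃ n (.inl (by lia)),
      ⟨Iso.refl _⟩⟩

instance : (degreeZeroEmbedding A).Full := by
  unfold degreeZeroEmbedding
  infer_instance

instance : (degreeZeroEmbedding A).Faithful where
  map_injective {X Y} f g hfg := by
    apply (HomologicalComplex.single A (ComplexShape.up ℤ) 0).map_injective
    have H := HomotopyCategory.homotopyOfEq _ _ hfg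
    refine HomologicalComplex.hom_ext _ _ fun n => ?_
    have hcomm := H.comm n
    rw [dNext_eq H.hom (show (ComplexShape.up ℤ).Rel n (n + 1) from rfl),
      prevD_eq H.hom (show (ComplexShape.up ℤ).Rel (n - 1) n from sub_add_cancel n 1),
      HomologicalComplex.single_obj_d, HomologicalComplex.single_obj_d, zero_comp, comp_zero,
      zero_add, zero_add] at hcomm
    exact hcomm

omit [HasBinaryBiproducts A] in
lemma degreeZeroEmbedding_obj_mem (a : A) :
    (degreeZeroEmbedding A).obj a ∈ KbLE A ∩ KbGE A := by
  have h (n : ℤ) (hn : n ≠ 0) :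
      IsZero (((HomologicalComplex.single A (ComplexShape.up ℤ) 0).obj a).X n) :=
    HomologicalComplex.isZero_single_obj_X _ 0 _ n hn
  exact ⟨⟨_, ⟨0, fun n hn => h n (by lia)⟩, fun n hn => h n (by lia), ⟨Iso.refl _⟩⟩,
    ⟨_, fun n hn => h n (by lia), ⟨0, fun n hn => h n (by lia)⟩, ⟨Iso.refl _⟩⟩⟩

omit [HasBinaryBiproducts A] in
lemma exists_iso_degreeZeroEmbedding_obj [IsIdempotentComplete A]
    (X : HomotopyCategory A (ComplexShape.up ℤ)) (hX : X ∈ KbLE A ∩ KbGE A) :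
    ∃ a : A, Nonempty (X ≅ (degreeZeroEmbedding A).obj a) := by
  obtain ⟨⟨Y, -, hY, ⟨e⟩⟩, ⟨Z, hZ, ⟨b, hb⟩, ⟨e'⟩⟩⟩ := hX
  obtain ⟨W, hW, hW', ⟨e''⟩⟩ := exists_iso_quotient_of_retract Z Y (e.inv ≫ e'.hom)
    (e'.inv ≫ e.hom) (by simp) 0 (max b 1) (by lia) (by
      rintro n (hn | hn)
      · exact hZ n hn
      · exact hb n (by lia))
  obtain ⟨e₀⟩ := nonempty_iso_single_of_isZero W (fun n hn => by
    rcases lt_or_gt_of_ne hn with hn | hn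
    · exact hW n (.inl hn)
    · exact hW' n (hY n hn))
  exact ⟨W.X 0, ⟨e ≪≫ e'' ≪≫ (HomotopyCategory.quotient A (ComplexShape.up ℤ)).mapIso e₀⟩⟩

end

/-- The stupid filtration weight structure on `K^b(A)` for an idempotent-complete
additive category `A`: `(KbLE A, KbGE A)` satisfies all the axioms of a bounded
weight structure on `K^b(A)`, and its heart is equivalent to `A` via the embedding
of `A` as complexes concentrated in degree `0`. -/
theorem Kb_weightStructure_of_idempotentComplete [IsIdempotentComplete A] :
    -- both classes consist of objects of K^b(A)
    (KbLE A ⊆ KbObj A ∧ KbGE A ⊆ KbObj A) ∧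
    -- idempotent-closedness: both classes are closed under retracts (and they are
    -- closed under isomorphism by definition)
    (∀ {X Y : HomotopyCategory A (ComplexShape.up ℤ)} (i : Y ⟶ X) (r : X ⟶ Y),
      i ≫ r = 𝟙 Y → X ∈ KbLE A → Y ∈ KbLE A) ∧
    (∀ {X Y : HomotopyCategory A (ComplexShape.up ℤ)} (i : Y ⟶ X) (r : X ⟶ Y),
      i ≫ r = 𝟙 Y → X ∈ KbGE A → Y ∈ KbGE A) ∧
    -- (1) `C^{w≤0} ⊆ C^{w≤1}` and `C^{w≥1} ⊆ C^{w≥0}`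
    (∀ X ∈ KbLE A, X⟦(1 : ℤ)⟧ ∈ KbLE A) ∧
    (∀ X ∈ KbGE A, X⟦(-1 : ℤ)⟧ ∈ KbGE A) ∧
    -- (2) orthogonality: `Hom(X, Y) = 0` for `X ∈ C^{w≥0}`, `Y ∈ C^{w≤-1}`
    (∀ {X Y : HomotopyCategory A (ComplexShape.up ℤ)}, X ∈ KbGE A →
      Y⟦(-1 : ℤ)⟧ ∈ KbLE A → ∀ f : X ⟶ Y, f = 0) ∧
    -- (3) weight decompositions inside `K^b(A)`
    (∀ X ∈ KbObj A, ∃ (P Q : HomotopyCategory A (ComplexShape.up ℤ))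
      (f : P ⟶ X) (g : X ⟶ Q) (h : Q ⟶ P⟦(1 : ℤ)⟧),
      (Triangle.mk f g h ∈ distTriang (HomotopyCategory A (ComplexShape.up ℤ))) ∧
        P⟦(1 : ℤ)⟧ ∈ KbGE A ∧ Q ∈ KbLE A) ∧
    -- boundedness: every object of `K^b(A)` lies in some `C^{w≤n}` and some `C^{w≥n}`
    (∀ X ∈ KbObj A, (∃ n : ℤ, X⟦n⟧ ∈ KbLE A) ∧ (∃ n : ℤ, X⟦n⟧ ∈ KbGE A)) ∧
    -- the heart is equivalent to `A` via the degree-zero embedding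
    (degreeZeroEmbedding A).Full ∧ (degreeZeroEmbedding A).Faithful ∧
    (∀ a : A, (degreeZeroEmbedding A).obj a ∈ KbLE A ∩ KbGE A) ∧
    (∀ X ∈ KbLE A ∩ KbGE A, ∃ a : A,
      Nonempty (X ≅ (degreeZeroEmbedding A).obj a)) := by
  refine ⟨⟨?_, ?_⟩, kbLE_of_retract, kbGE_of_retract, ?_, ?_, eq_zero_of_kbGE_of_kbLE,
    exists_weight_decomposition, ?_, inferInstance, inferInstance, degreeZeroEmbedding_obj_mem,
    exists_iso_degreeZeroEmbedding_obj⟩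
  · rintro X ⟨Y, ha, hY, e⟩
    exact ⟨Y, ha, ⟨0, hY⟩, e⟩
  · rintro X ⟨Y, hY, hb, e⟩
    exact ⟨Y, ⟨0, hY⟩, hb, e⟩
  · rintro X ⟨Y, ⟨a, ha⟩, hY, ⟨e⟩⟩
    exact ⟨Y⟦(1 : ℤ)⟧, ⟨a - 1, fun n hn => ha (n + 1) (by lia)⟩,
      fun n hn => hY (n + 1) (by lia), ⟨shiftIsoQuotientShift e 1⟩⟩
  · rintro X ⟨Y, hY, ⟨b, hb⟩, ⟨e⟩⟩
    exact ⟨Y⟦(-1 : ℤ)⟧, fun n hn => hY (n + -1) (by lia),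
      ⟨b + 1, fun n hn => hb (n + -1) (by lia)⟩, ⟨shiftIsoQuotientShift e (-1)⟩⟩
  · rintro X ⟨Y, ⟨a, ha⟩, ⟨b, hb⟩, ⟨e⟩⟩
    refine ⟨⟨b, Y⟦b⟧, ⟨a - b, fun n hn => ha (n + b) (by lia)⟩,
      fun n hn => hb (n + b) (by lia), ⟨shiftIsoQuotientShift e b⟩⟩,
      ⟨a, Y⟦a⟧, fun n hn => ha (n + a) (by lia), ⟨b - a, fun n hn => hb (n + a) (by lia)⟩,
      ⟨shiftIsoQuotientShift e a⟩⟩⟩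
end

section
/- Let C be an idempotent-closed triangulated category and T a collection of objects of C. Assume that T is negative (i.e. Hom_C(M, N[n]) = 0 for all M, N ∈ T and all n > 0) and that T generates C under isomorphisms, direct summands and distinguished triangles, i.e. C = ⟨T⟩_{≅,⊕-summand,Δ}. Then there is a bounded weight structure on C whose heart C^{w=0} equals the full subcategory ⟨T⟩_{≅,⊕-summand,⊕} of C generated by T under isomorphisms, direct summands and finite direct sums. -/
/-!
STATEMENT 2: If `T` is a negative collection of objects generating an idempotent-closed
triangulated category `C` under isomorphisms, direct summands and distinguished
triangles, then there is a bounded weight structure on `C` whose heart is the full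
subcategory generated by `T` under isomorphisms, direct summands and finite direct sums.
-/

open CategoryTheory Limits Pretriangulated

universe v u

variable (C : Type u) [Category.{v} C] [HasZeroObject C] [Preadditive C]
  [HasShift C ℤ] [∀ n : ℤ, (shiftFunctor C n).Additive] [Pretriangulated C]

/-- A weight structure `w = (C^{w≤0}, C^{w≥0})` on a triangulated category `C`,
following Bondarko, with the convention `C^{w≤n} := C^{w≤0}[-n]`, `C^{w≥n} := C^{w≥0}[-n]`. -/
structure WeightStructure where
  /-- the subcategory `C^{w≤0}` -/
  le : Set C
  /-- the subcategory `C^{w≥0}` -/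
  ge : Set C
  /-- `C^{w≤0}` is closed under isomorphism -/
  le_iso_closed : ∀ {X Y : C}, (X ≅ Y) → X ∈ le → Y ∈ le
  /-- `C^{w≥0}` is closed under isomorphism -/
  ge_iso_closed : ∀ {X Y : C}, (X ≅ Y) → X ∈ ge → Y ∈ ge
  /-- `C^{w≤0}` is idempotent-closed (closed under direct summands/retracts) -/
  le_summand : ∀ {X Y : C} (i : Y ⟶ X) (r : X ⟶ Y), i ≫ r = 𝟙 Y → X ∈ le → Y ∈ le
  /-- `C^{w≥0}` is idempotent-closed (closed under direct summands/retracts) -/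
  ge_summand : ∀ {X Y : C} (i : Y ⟶ X) (r : X ⟶ Y), i ≫ r = 𝟙 Y → X ∈ ge → Y ∈ ge
  /-- `C^{w≤0} ⊆ C^{w≤1}` -/
  le_shift : ∀ X ∈ le, X⟦(1 : ℤ)⟧ ∈ le
  /-- `C^{w≥1} ⊆ C^{w≥0}` -/
  ge_shift : ∀ X ∈ ge, X⟦(-1 : ℤ)⟧ ∈ ge
  /-- orthogonality: `Hom(X, Y) = 0` for `X ∈ C^{w≥0}` and `Y ∈ C^{w≤-1}` -/
  hom_zero : ∀ {X Y : C}, X ∈ ge → Y⟦(-1 : ℤ)⟧ ∈ le → ∀ f : X ⟶ Y, f = 0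
  /-- weight decomposition triangles `A ⟶ X ⟶ B ⟶ A⟦1⟧` with `A ∈ C^{w≥1}`, `B ∈ C^{w≤0}` -/
  exists_triangle : ∀ X : C, ∃ (A B : C) (f : A ⟶ X) (g : X ⟶ B) (h : B ⟶ A⟦(1 : ℤ)⟧),
    (Triangle.mk f g h ∈ distTriang C) ∧ A⟦(1 : ℤ)⟧ ∈ ge ∧ B ∈ le

variable {C}

/-- The heart `C^{w=0} = C^{w≤0} ∩ C^{w≥0}` of a weight structure. -/
def WeightStructure.heart (w : WeightStructure C) : Set C := w.le ∩ w.ge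

/-- a weight structure is bounded if `⋃ᵢ C^{w≤i} = ⋃ᵢ C^{w≥i} = C` -/
def WeightStructure.IsBounded (w : WeightStructure C) : Prop :=
  ∀ X : C, (∃ n : ℤ, X⟦n⟧ ∈ w.le) ∧ (∃ n : ℤ, X⟦n⟧ ∈ w.ge)

/-- the closure `⟨T⟩_{≅, ⊕-summand, Δ}` of a collection of objects of a triangulated
category under isomorphisms, direct summands, (de)suspensions and distinguished
triangles -/
inductive triangulatedClosure (T : Set C) : C → Prop
  | of {X : C} : X ∈ T → triangulatedClosure T X
  | zero {X : C} : IsZero X → triangulatedClosure T X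
  | iso {X Y : C} : (X ≅ Y) → triangulatedClosure T X → triangulatedClosure T Y
  | summand {X Y : C} (i : Y ⟶ X) (r : X ⟶ Y) :
      i ≫ r = 𝟙 Y → triangulatedClosure T X → triangulatedClosure T Y
  | shift {X : C} (n : ℤ) : triangulatedClosure T X → triangulatedClosure T (X⟦n⟧)
  | ext₂ (Tr : Triangle C) : (Tr ∈ distTriang C) → triangulatedClosure T Tr.obj₁ →
      triangulatedClosure T Tr.obj₃ → triangulatedClosure T Tr.obj₂

/-- the closure `⟨T⟩_{≅, ⊕-summand, ⊕}` of a collection of objects under isomorphisms,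
direct summands and finite direct sums -/
inductive additiveClosure [HasBinaryBiproducts C] (T : Set C) : C → Prop
  | of {X : C} : X ∈ T → additiveClosure T X
  | zero {X : C} : IsZero X → additiveClosure T X
  | iso {X Y : C} : (X ≅ Y) → additiveClosure T X → additiveClosure T Y
  | summand {X Y : C} (i : Y ⟶ X) (r : X ⟶ Y) :
      i ≫ r = 𝟙 Y → additiveClosure T X → additiveClosure T Y
  | sum {X Y : C} : additiveClosure T X → additiveClosure T Y →
      additiveClosure T (X ⊞ Y)

set_option linter.unusedSectionVars false

/-- There are no nonzero morphisms from `X` to `Y`. -/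
def HomVanishes (X Y : C) : Prop := ∀ f : X ⟶ Y, f = 0

namespace HomVanishes

theorem of_retract_left {X X' Y : C} (h : HomVanishes X Y) (i : X' ⟶ X) (r : X ⟶ X')
    (hir : i ≫ r = 𝟙 X') : HomVanishes X' Y := fun f => by
  rw [← Category.id_comp f, ← hir, Category.assoc, h (r ≫ f), comp_zero]

theorem of_retract_right {X Y Y' : C} (h : HomVanishes X Y) (i : Y' ⟶ Y) (r : Y ⟶ Y')
    (hir : i ≫ r = 𝟙 Y') : HomVanishes X Y' := fun f => by
  rw [← Category.comp_id f, ← hir, ← Category.assoc, h (f ≫ i), zero_comp]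

theorem of_iso_left {X X' Y : C} (h : HomVanishes X Y) (e : X ≅ X') : HomVanishes X' Y :=
  h.of_retract_left e.inv e.hom e.inv_hom_id

theorem of_iso_right {X Y Y' : C} (h : HomVanishes X Y) (e : Y ≅ Y') : HomVanishes X Y' :=
  h.of_retract_right e.inv e.hom e.inv_hom_id

theorem of_shift {X Y : C} (m : ℤ) (h : HomVanishes (X⟦m⟧) (Y⟦m⟧)) : HomVanishes X Y :=
  fun f => (shiftFunctor C m).map_injective (by rw [h (f⟦m⟧'), Functor.map_zero])

end HomVanishes

namespace DistTriang

section

variable {X Y Z : C} {f : X ⟶ Y} {g : Y ⟶ Z} {h : Z ⟶ X⟦(1 : ℤ)⟧}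

theorem comp₁₂ (H : Triangle.mk f g h ∈ distTriang C) : f ≫ g = 0 :=
  comp_distTriang_mor_zero₁₂ _ H

theorem comp₂₃ (H : Triangle.mk f g h ∈ distTriang C) : g ≫ h = 0 :=
  comp_distTriang_mor_zero₂₃ _ H

theorem comp₃₁ (H : Triangle.mk f g h ∈ distTriang C) : h ≫ f⟦(1 : ℤ)⟧' = 0 :=
  comp_distTriang_mor_zero₃₁ _ H

theorem shift_one (H : Triangle.mk f g h ∈ distTriang C) :
    Triangle.mk (-f⟦(1 : ℤ)⟧') (-g⟦(1 : ℤ)⟧') (-h⟦(1 : ℤ)⟧') ∈ distTriang C :=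
  rot_of_distTriang _ (rot_of_distTriang _ (rot_of_distTriang _ H))

theorem coyoneda₂ (H : Triangle.mk f g h ∈ distTriang C) {P : C} (x : P ⟶ Y) (hx : x ≫ g = 0) :
    ∃ y : P ⟶ X, x = y ≫ f :=
  Triangle.coyoneda_exact₂ _ H x hx

theorem coyoneda₃ (H : Triangle.mk f g h ∈ distTriang C) {P : C} (x : P ⟶ Z) (hx : x ≫ h = 0) :
    ∃ y : P ⟶ Y, x = y ≫ g :=
  Triangle.coyoneda_exact₃ _ H x hx

theorem coyoneda₁ (H : Triangle.mk f g h ∈ distTriang C) {P : C} (x : P ⟶ X⟦(1 : ℤ)⟧)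
    (hx : x ≫ f⟦(1 : ℤ)⟧' = 0) : ∃ y : P ⟶ Z, x = y ≫ h :=
  Triangle.coyoneda_exact₁ _ H x hx

theorem coyoneda₂_shift (H : Triangle.mk f g h ∈ distTriang C) {P : C} (x : P ⟶ Y⟦(1 : ℤ)⟧)
    (hx : x ≫ g⟦(1 : ℤ)⟧' = 0) : ∃ y : P ⟶ X⟦(1 : ℤ)⟧, x = y ≫ f⟦(1 : ℤ)⟧' := by
  obtain ⟨y, hy⟩ := coyoneda₂ (shift_one H) x (by rw [Preadditive.comp_neg, hx, neg_zero])
  exact ⟨-y, by rw [hy, Preadditive.comp_neg, Preadditive.neg_comp]⟩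

theorem yoneda₂ (H : Triangle.mk f g h ∈ distTriang C) {Q : C} (x : Y ⟶ Q) (hx : f ≫ x = 0) :
    ∃ y : Z ⟶ Q, x = g ≫ y :=
  Triangle.yoneda_exact₂ _ H x hx

theorem yoneda₃ (H : Triangle.mk f g h ∈ distTriang C) {Q : C} (x : Z ⟶ Q) (hx : g ≫ x = 0) :
    ∃ y : X⟦(1 : ℤ)⟧ ⟶ Q, x = h ≫ y :=
  Triangle.yoneda_exact₃ _ H x hx

theorem yoneda₁ (H : Triangle.mk f g h ∈ distTriang C) {Q : C} (x : X⟦(1 : ℤ)⟧ ⟶ Q)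
    (hx : h ≫ x = 0) : ∃ y : Y⟦(1 : ℤ)⟧ ⟶ Q, x = f⟦(1 : ℤ)⟧' ≫ y := by
  obtain ⟨y, hy⟩ := yoneda₃ (f := g) (g := h) (h := -f⟦(1 : ℤ)⟧') (rot_of_distTriang _ H) x hx
  exact ⟨-y, by rw [hy, Preadditive.comp_neg, Preadditive.neg_comp]⟩

theorem yoneda₂_shift (H : Triangle.mk f g h ∈ distTriang C) {Q : C} (x : Y⟦(1 : ℤ)⟧ ⟶ Q)
    (hx : f⟦(1 : ℤ)⟧' ≫ x = 0) : ∃ y : Z⟦(1 : ℤ)⟧ ⟶ Q, x = g⟦(1 : ℤ)⟧' ≫ y := by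
  obtain ⟨y, hy⟩ := yoneda₂ (shift_one H) x (by rw [Preadditive.neg_comp, hx, neg_zero])
  exact ⟨-y, by rw [hy, Preadditive.comp_neg, Preadditive.neg_comp]⟩

theorem homVanishes_left (H : Triangle.mk f g h ∈ distTriang C) {Q : C}
    (hX : HomVanishes X Q) (hZ : HomVanishes Z Q) : HomVanishes Y Q := fun x => by
  obtain ⟨y, rfl⟩ := yoneda₂ H x (hX _)
  rw [hZ y, comp_zero]

theorem homVanishes_right (H : Triangle.mk f g h ∈ distTriang C) {P : C}
    (hX : HomVanishes P X) (hZ : HomVanishes P Z) : HomVanishes P Y := fun x => by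
  obtain ⟨y, rfl⟩ := coyoneda₂ H x (hZ _)
  rw [hX y, zero_comp]

/-- Up to isomorphism of the terms, the shift of a distinguished triangle is distinguished. -/
theorem exists_shift (H : Triangle.mk f g h ∈ distTriang C) (n : ℤ) :
    ∃ (f' : X⟦n⟧ ⟶ Y⟦n⟧) (g' : Y⟦n⟧ ⟶ Z⟦n⟧) (h' : Z⟦n⟧ ⟶ X⟦n⟧⟦(1 : ℤ)⟧),
      Triangle.mk f' g' h' ∈ distTriang C :=
  ⟨_, _, _, Triangle.shift_distinguished _ H n⟩

theorem of_isZero_left {X : C} (h : IsZero X) (Y : C) :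
    Triangle.mk (0 : X ⟶ Y) (𝟙 Y) 0 ∈ distTriang C :=
  (Triangle.distinguished_iff_of_isZero₁ _ h).2 (inferInstanceAs (IsIso (𝟙 Y)))

theorem of_isZero_right {Z : C} (h : IsZero Z) (X : C) :
    Triangle.mk (𝟙 X) (0 : X ⟶ Z) 0 ∈ distTriang C :=
  (Triangle.distinguished_iff_of_isZero₃ _ h).2 (inferInstanceAs (IsIso (𝟙 X)))

theorem of_iso₂ (H : Triangle.mk f g h ∈ distTriang C) {Y' : C} (e : Y ≅ Y') {f' : X ⟶ Y'}
    {g' : Y' ⟶ Z} (hf : f ≫ e.hom = f') (hg : e.hom ≫ g' = g) :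
    Triangle.mk f' g' h ∈ distTriang C :=
  isomorphic_distinguished _ H _ (Triangle.isoMk _ _ (Iso.refl _) e.symm (Iso.refl _)
    (by change f' ≫ e.inv = 𝟙 X ≫ f; simp [← hf])
    (by change g' ≫ 𝟙 Z = e.inv ≫ g; simp [← hg])
    (by change h ≫ (𝟙 X)⟦(1 : ℤ)⟧' = 𝟙 Z ≫ h; simp))

end

variable {A₁ A₂ A₃ X₁ X₂ X₃ B₁ B₂ B₃ : C}
  {a₁ : A₁ ⟶ X₁} {b₁ : X₁ ⟶ B₁} {c₁ : B₁ ⟶ A₁⟦(1 : ℤ)⟧}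
  {a₂ : A₂ ⟶ X₂} {b₂ : X₂ ⟶ B₂} {c₂ : B₂ ⟶ A₂⟦(1 : ℤ)⟧}
  {a₃ : A₃ ⟶ X₃} {b₃ : X₃ ⟶ B₃} {c₃ : B₃ ⟶ A₃⟦(1 : ℤ)⟧}

/-- Given a morphism of distinguished triangles, morphisms from `P` to the cone of the middle
component vanish if those to the cones of the outer components do. -/
theorem homVanishes_cone {u : A₁ ⟶ A₂} {v : A₂ ⟶ A₃} {w : A₃ ⟶ A₁⟦(1 : ℤ)⟧}
    {f : X₁ ⟶ X₂} {g : X₂ ⟶ X₃} {h : X₃ ⟶ X₁⟦(1 : ℤ)⟧}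
    (hA : Triangle.mk u v w ∈ distTriang C) (hX : Triangle.mk f g h ∈ distTriang C)
    (h₁ : Triangle.mk a₁ b₁ c₁ ∈ distTriang C) (h₂ : Triangle.mk a₂ b₂ c₂ ∈ distTriang C)
    (h₃ : Triangle.mk a₃ b₃ c₃ ∈ distTriang C)
    (comm₁ : u ≫ a₂ = a₁ ≫ f) (comm₂ : v ≫ a₃ = a₂ ≫ g) (comm₃ : w ≫ a₁⟦(1 : ℤ)⟧' = a₃ ≫ h)
    {P : C} (hP₁ : HomVanishes P B₁) (hP₃ : HomVanishes P B₃) : HomVanishes P B₂ := by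
  have inj₁ (x : P ⟶ A₁⟦(1 : ℤ)⟧) (hx : x ≫ a₁⟦(1 : ℤ)⟧' = 0) : x = 0 := by
    obtain ⟨y, rfl⟩ := coyoneda₁ h₁ x hx
    rw [hP₁ y, zero_comp]
  have inj₃ (x : P ⟶ A₃⟦(1 : ℤ)⟧) (hx : x ≫ a₃⟦(1 : ℤ)⟧' = 0) : x = 0 := by
    obtain ⟨y, rfl⟩ := coyoneda₁ h₃ x hx
    rw [hP₃ y, zero_comp]
  intro p
  have hp : p ≫ c₂ = 0 := by
    have hq : (p ≫ c₂) ≫ a₂⟦(1 : ℤ)⟧' = 0 := by rw [Category.assoc, comp₃₁ h₂, comp_zero]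
    generalize p ≫ c₂ = q at hq
    obtain ⟨q₁, rfl⟩ := coyoneda₂_shift hA q (inj₃ _ (by
      rw [Category.assoc, ← Functor.map_comp, comm₂, Functor.map_comp, ← Category.assoc, hq,
        zero_comp]))
    obtain ⟨s, hs⟩ := coyoneda₁ hX (q₁ ≫ a₁⟦(1 : ℤ)⟧') (by
      rw [Category.assoc, ← Functor.map_comp, ← comm₁, Functor.map_comp, ← Category.assoc, hq])
    obtain ⟨t, rfl⟩ := coyoneda₂ h₃ s (hP₃ _)
    have : q₁ - t ≫ w = 0 := inj₁ _ (by
      rw [Preadditive.sub_comp, hs, Category.assoc, Category.assoc, comm₃, sub_self])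
    rw [sub_eq_zero.1 this, Category.assoc, comp₃₁ hA, comp_zero]
  obtain ⟨x, rfl⟩ := coyoneda₃ h₂ p hp
  obtain ⟨t, ht⟩ := coyoneda₂ h₃ (x ≫ g) (hP₃ _)
  obtain ⟨y, rfl⟩ := coyoneda₃ hA t (inj₁ _ (by
    rw [Category.assoc, comm₃, ← Category.assoc, ← ht, Category.assoc, comp₂₃ hX, comp_zero]))
  obtain ⟨z, hz⟩ := coyoneda₂ hX (x - y ≫ a₂) (by
    rw [Preadditive.sub_comp, ht, Category.assoc, Category.assoc, comm₂, sub_self])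
  obtain ⟨w, rfl⟩ := coyoneda₂ h₁ z (hP₁ _)
  have hx : x = (y + w ≫ u) ≫ a₂ := by
    rw [Preadditive.add_comp, Category.assoc w, comm₁, ← Category.assoc w, ← hz,
      add_sub_cancel]
  rw [hx, Category.assoc, comp₁₂ h₂, comp_zero]

/-- Given a morphism of distinguished triangles, morphisms to `Q` from the shifted fiber of the
middle component vanish if those from the shifted fibers of the outer components do. -/
theorem homVanishes_fiber {f : X₁ ⟶ X₂} {g : X₂ ⟶ X₃} {h : X₃ ⟶ X₁⟦(1 : ℤ)⟧}
    {u : B₁ ⟶ B₂} {v : B₂ ⟶ B₃} {w : B₃ ⟶ B₁⟦(1 : ℤ)⟧}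
    (hX : Triangle.mk f g h ∈ distTriang C) (hB : Triangle.mk u v w ∈ distTriang C)
    (h₁ : Triangle.mk a₁ b₁ c₁ ∈ distTriang C) (h₂ : Triangle.mk a₂ b₂ c₂ ∈ distTriang C)
    (h₃ : Triangle.mk a₃ b₃ c₃ ∈ distTriang C)
    (comm₁ : f ≫ b₂ = b₁ ≫ u) (comm₂ : g ≫ b₃ = b₂ ≫ v) (comm₃ : h ≫ b₁⟦(1 : ℤ)⟧' = b₃ ≫ w)
    {Q : C} (hQ₁ : HomVanishes (A₁⟦(1 : ℤ)⟧) Q) (hQ₃ : HomVanishes (A₃⟦(1 : ℤ)⟧) Q) :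
    HomVanishes (A₂⟦(1 : ℤ)⟧) Q := by
  have inj₁ (x : B₁ ⟶ Q) (hx : b₁ ≫ x = 0) : x = 0 := by
    obtain ⟨y, rfl⟩ := yoneda₃ h₁ x hx
    rw [hQ₁ y, comp_zero]
  have inj₃ (x : B₃ ⟶ Q) (hx : b₃ ≫ x = 0) : x = 0 := by
    obtain ⟨y, rfl⟩ := yoneda₃ h₃ x hx
    rw [hQ₃ y, comp_zero]
  intro q
  have hq : c₂ ≫ q = 0 := by
    have hr : b₂ ≫ c₂ ≫ q = 0 := by rw [← Category.assoc, comp₂₃ h₂, zero_comp]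
    generalize c₂ ≫ q = r at hr
    obtain ⟨r₃, rfl⟩ := yoneda₂ hB r (inj₁ _ (by
      rw [← Category.assoc, ← comm₁, Category.assoc, hr, comp_zero]))
    obtain ⟨s, hs⟩ := yoneda₃ hX (b₃ ≫ r₃) (by
      rw [← Category.assoc, comm₂, Category.assoc, hr])
    obtain ⟨t, rfl⟩ := yoneda₂_shift h₁ s (hQ₁ _)
    have : r₃ - w ≫ t = 0 := inj₃ _ (by
      rw [Preadditive.comp_sub, hs, ← Category.assoc, ← Category.assoc, comm₃, sub_self])
    rw [sub_eq_zero.1 this, ← Category.assoc, comp₂₃ hB, zero_comp]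
  obtain ⟨x, rfl⟩ := yoneda₁ h₂ q hq
  obtain ⟨t, ht⟩ := yoneda₂_shift h₁ (f⟦(1 : ℤ)⟧' ≫ x) (hQ₁ _)
  obtain ⟨y, rfl⟩ := yoneda₁ hB t (inj₃ _ (by
    rw [← Category.assoc, ← comm₃, Category.assoc, ← ht, ← Category.assoc, comp₃₁ hX,
      zero_comp]))
  obtain ⟨z, hz⟩ := yoneda₂_shift hX (x - b₂⟦(1 : ℤ)⟧' ≫ y) (by
    rw [Preadditive.comp_sub, ht, ← Category.assoc, ← Category.assoc, ← Functor.map_comp,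
      ← Functor.map_comp, comm₁, sub_self])
  obtain ⟨w, rfl⟩ := yoneda₂_shift h₃ z (hQ₃ _)
  have hx : x = b₂⟦(1 : ℤ)⟧' ≫ (y + v⟦(1 : ℤ)⟧' ≫ w) := by
    rw [Preadditive.comp_add, ← Category.assoc _ _ w, ← Functor.map_comp, ← comm₂,
      Functor.map_comp, Category.assoc, ← hz, add_sub_cancel]
  rw [hx, ← Category.assoc, ← Functor.map_comp, comp₁₂ h₂, Functor.map_zero, zero_comp]

end DistTriang

/-- Objects of weight at most `n`: those receiving no nonzero morphism from `M⟦j⟧`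
for `M ∈ T` and `j < -n`. -/
def WeightLE (T : Set C) (n : ℤ) (Y : C) : Prop :=
  ∀ M ∈ T, ∀ j : ℤ, j < -n → HomVanishes (M⟦j⟧) Y

/-- Objects of weight at least `n`: those without nonzero morphisms to objects of weight
at most `n - 1`. -/
def WeightGE (T : Set C) (n : ℤ) (X : C) : Prop :=
  ∀ Y : C, WeightLE T (n - 1) Y → HomVanishes X Y

section

open ZeroObject

variable {T : Set C} {n m : ℤ} {X Y Z : C}

namespace WeightLE

theorem mono (h : WeightLE T n X) (hnm : n ≤ m) : WeightLE T m X :=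
  fun M hM j hj => h M hM j (by omega)

theorem of_retract (h : WeightLE T n X) (i : Y ⟶ X) (r : X ⟶ Y) (hir : i ≫ r = 𝟙 Y) :
    WeightLE T n Y :=
  fun M hM j hj => (h M hM j hj).of_retract_right i r hir

theorem of_iso (h : WeightLE T n X) (e : X ≅ Y) : WeightLE T n Y :=
  h.of_retract e.inv e.hom e.inv_hom_id

theorem of_isZero (hX : IsZero X) : WeightLE T n X := fun _ _ _ _ _ => hX.eq_of_tgt _ _

theorem of_distTriang {f : X ⟶ Y} {g : Y ⟶ Z} {h : Z ⟶ X⟦(1 : ℤ)⟧}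
    (H : Triangle.mk f g h ∈ distTriang C) (hX : WeightLE T n X) (hZ : WeightLE T n Z) :
    WeightLE T n Y :=
  fun M hM j hj => DistTriang.homVanishes_right H (hX M hM j hj) (hZ M hM j hj)

theorem biprod [HasBinaryBiproducts C] (hX : WeightLE T n X) (hY : WeightLE T n Y) :
    WeightLE T n (X ⊞ Y) :=
  of_distTriang (binaryBiproductTriangle_distinguished X Y) hX hY

theorem shift (h : WeightLE T n X) (m k : ℤ) (hk : k + m = n) : WeightLE T k (X⟦m⟧) :=
  fun M hM j hj => HomVanishes.of_shift (-m)
    (((h M hM (j + -m) (by omega)).of_iso_left (shiftAdd M j (-m))).of_iso_right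
      (shiftShiftNeg X m).symm)

theorem of_shift (m k : ℤ) (h : WeightLE T k (X⟦m⟧)) (hk : k + m = n) : WeightLE T n X :=
  (h.shift (-m) n (by omega)).of_iso (shiftShiftNeg X m)

theorem of_mem (hneg : ∀ M ∈ T, ∀ N ∈ T, ∀ n : ℤ, 0 < n → ∀ f : M ⟶ N⟦n⟧, f = 0)
    (hX : X ∈ T) : WeightLE T 0 X :=
  fun M hM j hj => HomVanishes.of_shift (-j)
    (HomVanishes.of_iso_left (hneg M hM X hX (-j) (by omega)) (shiftShiftNeg M j).symm)

end WeightLE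

namespace WeightGE

theorem anti (h : WeightGE T n X) (hmn : m ≤ n) : WeightGE T m X :=
  fun Y hY => h Y (hY.mono (by omega))

theorem of_retract (h : WeightGE T n X) (i : Y ⟶ X) (r : X ⟶ Y) (hir : i ≫ r = 𝟙 Y) :
    WeightGE T n Y :=
  fun Q hQ => (h Q hQ).of_retract_left i r hir

theorem of_iso (h : WeightGE T n X) (e : X ≅ Y) : WeightGE T n Y :=
  h.of_retract e.inv e.hom e.inv_hom_id

theorem of_isZero (hX : IsZero X) : WeightGE T n X := fun _ _ _ => hX.eq_of_src _ _

theorem of_distTriang {f : X ⟶ Y} {g : Y ⟶ Z} {h : Z ⟶ X⟦(1 : ℤ)⟧}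
    (H : Triangle.mk f g h ∈ distTriang C) (hX : WeightGE T n X) (hZ : WeightGE T n Z) :
    WeightGE T n Y :=
  fun Q hQ => DistTriang.homVanishes_left H (hX Q hQ) (hZ Q hQ)

theorem biprod [HasBinaryBiproducts C] (hX : WeightGE T n X) (hY : WeightGE T n Y) :
    WeightGE T n (X ⊞ Y) :=
  of_distTriang (binaryBiproductTriangle_distinguished X Y) hX hY

theorem shift (h : WeightGE T n X) (m k : ℤ) (hk : k + m = n) : WeightGE T k (X⟦m⟧) :=
  fun Y hY => HomVanishes.of_shift (-m)
    ((h (Y⟦-m⟧) (hY.shift (-m) (n - 1) (by omega))).of_iso_left (shiftShiftNeg X m).symm)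

theorem of_shift (m k : ℤ) (h : WeightGE T k (X⟦m⟧)) (hk : k + m = n) : WeightGE T n X :=
  (h.shift (-m) n (by omega)).of_iso (shiftShiftNeg X m)

theorem of_mem (hX : X ∈ T) : WeightGE T 0 X :=
  fun Y hY => (hY X hX 0 (by omega)).of_iso_left (shiftZero ℤ X)

end WeightGE

theorem exists_weightLE_and_weightGE
    (hneg : ∀ M ∈ T, ∀ N ∈ T, ∀ n : ℤ, 0 < n → ∀ f : M ⟶ N⟦n⟧, f = 0)
    (hX : triangulatedClosure T X) : ∃ a b : ℤ, WeightLE T a X ∧ WeightGE T b X := by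
  induction hX with
  | of h => exact ⟨0, 0, .of_mem hneg h, .of_mem h⟩
  | zero h => exact ⟨0, 0, .of_isZero h, .of_isZero h⟩
  | iso e _ ih =>
    obtain ⟨a, b, ha, hb⟩ := ih
    exact ⟨a, b, ha.of_iso e, hb.of_iso e⟩
  | summand i r hir _ ih =>
    obtain ⟨a, b, ha, hb⟩ := ih
    exact ⟨a, b, ha.of_retract i r hir, hb.of_retract i r hir⟩
  | shift n _ ih =>
    obtain ⟨a, b, ha, hb⟩ := ih
    exact ⟨a - n, b - n, ha.shift n _ (by omega), hb.shift n _ (by omega)⟩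
  | ext₂ Tr hTr _ _ ih₁ ih₃ =>
    obtain ⟨a, b, ha, hb⟩ := ih₁
    obtain ⟨a', b', ha', hb'⟩ := ih₃
    exact ⟨max a a', min b b',
      .of_distTriang hTr (ha.mono (le_max_left _ _)) (ha'.mono (le_max_right _ _)),
      .of_distTriang hTr (hb.anti (min_le_left _ _)) (hb'.anti (min_le_right _ _))⟩

variable [HasBinaryBiproducts C]

theorem additiveClosure.weightLE_zero
    (hneg : ∀ M ∈ T, ∀ N ∈ T, ∀ n : ℤ, 0 < n → ∀ f : M ⟶ N⟦n⟧, f = 0)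
    (hX : additiveClosure T X) : WeightLE T 0 X := by
  induction hX with
  | of h => exact .of_mem hneg h
  | zero h => exact .of_isZero h
  | iso e _ ih => exact ih.of_iso e
  | summand i r hir _ ih => exact ih.of_retract i r hir
  | sum _ _ ih ih' => exact ih.biprod ih'

theorem additiveClosure.weightGE_zero (hX : additiveClosure T X) : WeightGE T 0 X := by
  induction hX with
  | of h => exact .of_mem h
  | zero h => exact .of_isZero h
  | iso e _ ih => exact ih.of_iso e
  | summand i r hir _ ih => exact ih.of_retract i r hir
  | sum _ _ ih ih' => exact ih.biprod ih'

/-- `X` is an extension of an object of the additive closure of `T` by an object of weight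
at least `1`. -/
def HasTop (T : Set C) (X : C) : Prop :=
  ∃ (N M : C) (f : N ⟶ X) (g : X ⟶ M) (h : M ⟶ N⟦(1 : ℤ)⟧),
    Triangle.mk f g h ∈ distTriang C ∧ WeightGE T 0 (N⟦(1 : ℤ)⟧) ∧ additiveClosure T M

namespace HasTop

theorem weightGE (hX : HasTop T X) : WeightGE T 0 X := by
  obtain ⟨N, M, f, g, h, H, hN, hM⟩ := hX
  exact .of_distTriang H ((hN.of_shift 1 0 rfl).anti (by omega)) hM.weightGE_zero

theorem of_additiveClosure (hX : additiveClosure T X) : HasTop T X :=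
  ⟨0, X, 0, 𝟙 X, 0, DistTriang.of_isZero_left (isZero_zero C) X,
    (WeightGE.of_isZero (isZero_zero C) (n := 1)).shift 1 0 rfl, hX⟩

theorem of_weightGE_one (hX : WeightGE T 1 X) : HasTop T X :=
  ⟨X, 0, 𝟙 X, 0, 0, DistTriang.of_isZero_right (isZero_zero C) X, hX.shift 1 0 rfl,
    .zero (isZero_zero C)⟩

theorem of_distTriang
    (hneg : ∀ M ∈ T, ∀ N ∈ T, ∀ n : ℤ, 0 < n → ∀ f : M ⟶ N⟦n⟧, f = 0)
    {f : X ⟶ Y} {g : Y ⟶ Z} {h : Z ⟶ X⟦(1 : ℤ)⟧}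
    (H : Triangle.mk f g h ∈ distTriang C) (hX : HasTop T X) (hZ : HasTop T Z) :
    HasTop T Y := by
  have hZ₀ := hZ.weightGE
  obtain ⟨N₁, M₁, a₁, b₁, c₁, H₁, hN₁, hM₁⟩ := hX
  obtain ⟨N₃, M₃, a₃, b₃, c₃, H₃, hN₃, hM₃⟩ := hZ
  have comm : h ≫ b₁⟦(1 : ℤ)⟧' = b₃ ≫ 0 := by
    rw [hZ₀ _ ((hM₁.weightLE_zero hneg).shift 1 (0 - 1) rfl) (h ≫ b₁⟦(1 : ℤ)⟧'), comp_zero]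
  have hB : Triangle.mk (biprod.inl : M₁ ⟶ M₁ ⊞ M₃) biprod.snd 0 ∈ distTriang C :=
    binaryBiproductTriangle_distinguished M₁ M₃
  obtain ⟨b₂, comm₁, comm₂⟩ := complete_distinguished_triangle_morphism₂ _ _ H hB b₁ b₃ comm
  obtain ⟨N₂, a₂, c₂, H₂⟩ := distinguished_cocone_triangle₁ b₂
  exact ⟨N₂, _, a₂, b₂, c₂, H₂, fun Q hQ => DistTriang.homVanishes_fiber H hB H₁ H₂ H₃
    comm₁ comm₂ comm (hN₁ Q hQ) (hN₃ Q hQ), .sum hM₁ hM₃⟩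

/-- An object of weight zero with a top lies in the additive closure. -/
theorem additiveClosure_of_weightLE (hX : HasTop T X) (hX' : WeightLE T 0 X) :
    additiveClosure T X := by
  obtain ⟨N, M, f, g, h, H, hN, hM⟩ := hX
  have hf : f = 0 := hN.of_shift (n := 1) 1 0 rfl X hX' f
  obtain ⟨r, hr⟩ := DistTriang.yoneda₂ H (𝟙 X) (by rw [hf, zero_comp])
  exact .summand g r hr.symm hM

end HasTop

/-- `X` has a weight decomposition whose part of weight at least `1` has a top. -/
def HasWeightDecomposition (T : Set C) (X : C) : Prop :=
  ∃ (A B : C) (f : A ⟶ X) (g : X ⟶ B) (h : B ⟶ A⟦(1 : ℤ)⟧),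
    Triangle.mk f g h ∈ distTriang C ∧ HasTop T (A⟦(1 : ℤ)⟧) ∧ WeightLE T 0 B

namespace HasWeightDecomposition

theorem of_weightLE (hX : WeightLE T 0 X) : HasWeightDecomposition T X :=
  ⟨0, X, 0, 𝟙 X, 0, DistTriang.of_isZero_left (isZero_zero C) X,
    .of_additiveClosure (.zero ((shiftFunctor C (1 : ℤ)).map_isZero (isZero_zero C))), hX⟩

theorem of_hasTop (hX : HasTop T (X⟦(1 : ℤ)⟧)) : HasWeightDecomposition T X :=
  ⟨X, 0, 𝟙 X, 0, 0, DistTriang.of_isZero_right (isZero_zero C) X, hX,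
    .of_isZero (isZero_zero C)⟩

theorem of_iso (hX : HasWeightDecomposition T X) (e : X ≅ Y) : HasWeightDecomposition T Y := by
  obtain ⟨A, B, f, g, h, H, hA, hB⟩ := hX
  exact ⟨A, B, f ≫ e.hom, e.inv ≫ g, h, DistTriang.of_iso₂ H e rfl (by simp), hA, hB⟩

theorem of_distTriang
    (hneg : ∀ M ∈ T, ∀ N ∈ T, ∀ n : ℤ, 0 < n → ∀ f : M ⟶ N⟦n⟧, f = 0)
    {f : X ⟶ Y} {g : Y ⟶ Z} {h : Z ⟶ X⟦(1 : ℤ)⟧} (H : Triangle.mk f g h ∈ distTriang C)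
    (hX : HasWeightDecomposition T X) (hZ : HasWeightDecomposition T Z) :
    HasWeightDecomposition T Y := by
  obtain ⟨A₁, B₁, a₁, b₁, c₁, H₁, hA₁, hB₁⟩ := hX
  obtain ⟨A₃, B₃, a₃, b₃, c₃, H₃, hA₃, hB₃⟩ := hZ
  have hA₃B₁ : HomVanishes A₃ (B₁⟦(1 : ℤ)⟧) :=
    hA₃.weightGE.of_shift 1 0 (n := 1) rfl _ ((hB₁.shift 1 (-1) rfl).mono (by omega))
  obtain ⟨w, hw⟩ := DistTriang.coyoneda₂ (DistTriang.shift_one H₁) (a₃ ≫ h) (hA₃B₁ _)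
  have comm : (-w) ≫ a₁⟦(1 : ℤ)⟧' = a₃ ≫ h := by
    rw [hw, Preadditive.comp_neg, Preadditive.neg_comp]
  obtain ⟨A₂, u, v, hA⟩ := distinguished_cocone_triangle₂ (-w)
  obtain ⟨a₂, comm₁, comm₂⟩ := complete_distinguished_triangle_morphism₂ _ _ hA H a₁ a₃ comm
  obtain ⟨B₂, b₂, c₂, H₂⟩ := distinguished_cocone_triangle a₂
  exact ⟨A₂, B₂, a₂, b₂, c₂, H₂, .of_distTriang hneg (DistTriang.shift_one hA) hA₁ hA₃,
    fun M hM j hj => DistTriang.homVanishes_cone hA H H₁ H₂ H₃ comm₁ comm₂ comm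
      (hB₁ M hM j hj) (hB₃ M hM j hj)⟩

theorem of_mem_shift
    (hneg : ∀ M ∈ T, ∀ N ∈ T, ∀ n : ℤ, 0 < n → ∀ f : M ⟶ N⟦n⟧, f = 0)
    (hX : X ∈ T) (k : ℤ) : HasWeightDecomposition T (X⟦k⟧) := by
  rcases lt_trichotomy k (-1) with hk | rfl | hk
  · exact of_hasTop (.of_weightGE_one
      ((((WeightGE.of_mem hX).shift k (-k) (by omega)).shift 1 (-k - 1) (by omega)).anti
        (by omega)))
  · exact of_hasTop (.of_additiveClosure (.iso (shiftNegShift X (1 : ℤ)).symm (.of hX)))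
  · exact of_weightLE (((WeightLE.of_mem hneg hX).shift k (-k) (by omega)).mono (by omega))

/-- If all shifts of a direct sum have weight decompositions and the summands are bounded above,
then all shifts of the summands have weight decompositions. -/
theorem of_biprod_shift
    (hneg : ∀ M ∈ T, ∀ N ∈ T, ∀ n : ℤ, 0 < n → ∀ f : M ⟶ N⟦n⟧, f = 0)
    (h : ∀ k : ℤ, HasWeightDecomposition T ((X ⊞ Y)⟦k⟧))
    (hX : WeightLE T n X) (hY : WeightLE T n Y) (m : ℕ) (k : ℤ) (hk : n ≤ k + m) :
    HasWeightDecomposition T (X⟦k⟧) ∧ HasWeightDecomposition T (Y⟦k⟧) := by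
  induction m generalizing k with
  | zero =>
    exact ⟨of_weightLE ((hX.shift k (n - k) (by omega)).mono (by omega)),
      of_weightLE ((hY.shift k (n - k) (by omega)).mono (by omega))⟩
  | succ m ih =>
    have key (U V : C) (i : V ⟶ X ⊞ Y) (p : X ⊞ Y ⟶ U)
        (H : Triangle.mk i p 0 ∈ distTriang C) (hV : HasWeightDecomposition T (V⟦1 + k⟧)) :
        HasWeightDecomposition T (U⟦k⟧) := by
      obtain ⟨_, _, _, H'⟩ := DistTriang.exists_shift (rot_of_distTriang _ H) k
      exact of_distTriang hneg H' (h k) (hV.of_iso (shiftAdd V 1 k))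
    obtain ⟨hX', hY'⟩ := ih (1 + k) (by push_cast at hk; omega)
    have H : Triangle.mk (biprod.inr : Y ⟶ X ⊞ Y) biprod.fst 0 ∈ distTriang C :=
      DistTriang.of_iso₂ (f := biprod.inl) (g := biprod.snd)
        (binaryBiproductTriangle_distinguished Y X) (biprod.braiding Y X)
        (by ext <;> simp) (by simp)
    exact ⟨key X Y _ _ H hY', key Y X _ _ (binaryBiproductTriangle_distinguished X Y) hX'⟩

theorem shift_of_triangulatedClosure
    (hneg : ∀ M ∈ T, ∀ N ∈ T, ∀ n : ℤ, 0 < n → ∀ f : M ⟶ N⟦n⟧, f = 0)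
    (hX : triangulatedClosure T X) : ∀ k : ℤ, HasWeightDecomposition T (X⟦k⟧) := by
  induction hX with
  | of h => exact of_mem_shift hneg h
  | zero h => exact fun k => of_weightLE (.of_isZero ((shiftFunctor C k).map_isZero h))
  | iso e _ ih => exact fun k => (ih k).of_iso ((shiftFunctor C k).mapIso e)
  | @summand X Y i r hir hX ih =>
    obtain ⟨n, _, hn, _⟩ := exists_weightLE_and_weightGE hneg hX
    obtain ⟨Z, g, h, H⟩ := distinguished_cocone_triangle i
    have : Mono i := mono_of_mono_fac hir
    obtain ⟨e, -, -⟩ := exists_iso_binaryBiproduct_of_distTriang _ H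
      (Triangle.mor₃_eq_zero_of_mono₁ _ H this)
    have e : X ≅ Y ⊞ Z := e
    have hn' := hn.of_iso e
    exact fun k => (of_biprod_shift hneg (fun k => (ih k).of_iso ((shiftFunctor C k).mapIso e))
      (hn'.of_retract _ _ biprod.inl_fst) (hn'.of_retract _ _ biprod.inr_snd)
      (n - k).toNat k (by omega)).1
  | shift n _ ih => exact fun k => (ih (n + k)).of_iso (shiftAdd _ n k)
  | ext₂ Tr hTr _ _ ih₁ ih₃ =>
    intro k
    obtain ⟨_, _, _, H⟩ := DistTriang.exists_shift hTr k
    exact of_distTriang hneg H (ih₁ k) (ih₃ k)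

theorem of_triangulatedClosure
    (hneg : ∀ M ∈ T, ∀ N ∈ T, ∀ n : ℤ, 0 < n → ∀ f : M ⟶ N⟦n⟧, f = 0)
    (hX : triangulatedClosure T X) : HasWeightDecomposition T X :=
  (shift_of_triangulatedClosure hneg hX 0).of_iso (shiftZero ℤ X)

/-- Objects of weight zero lie in the additive closure. -/
theorem additiveClosure_of_weightLE_of_weightGE (hX : HasWeightDecomposition T (X⟦(-1 : ℤ)⟧))
    (hle : WeightLE T 0 X) (hge : WeightGE T 0 X) : additiveClosure T X := by
  obtain ⟨A, B, f, g, h, H, hA, hB⟩ := hX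
  let e : X⟦(-1 : ℤ)⟧⟦(1 : ℤ)⟧ ≅ X := shiftNegShift X (1 : ℤ)
  have hA' : WeightLE T 0 (A⟦(1 : ℤ)⟧) :=
    .of_distTriang (rot_of_distTriang _ (rot_of_distTriang _ H)) hB (hle.of_iso e.symm)
  obtain ⟨s, hs⟩ := DistTriang.coyoneda₂ (DistTriang.shift_one H) (𝟙 _)
    ((hge.of_iso e.symm) _ (hB.shift 1 (0 - 1) rfl) _)
  exact .iso e (.summand s _ hs.symm (hA.additiveClosure_of_weightLE hA'))

end HasWeightDecomposition

end

/-- Bondarko's construction of weight structures from negative generating collections: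
if the idempotent-closed triangulated category `C` is generated by a negative
collection of objects `T` under isomorphisms, direct summands and triangles, then `C`
carries a bounded weight structure whose heart is the full subcategory generated by `T`
under isomorphisms, direct summands and finite direct sums. -/
theorem exists_weightStructure_of_negative_generators
    [HasBinaryBiproducts C] [IsIdempotentComplete C] (T : Set C)
    (hneg : ∀ M ∈ T, ∀ N ∈ T, ∀ n : ℤ, 0 < n → ∀ f : M ⟶ N⟦n⟧, f = 0)
    (hgen : ∀ X : C, triangulatedClosure T X) :
    ∃ w : WeightStructure C, w.IsBounded ∧
      w.heart = {X : C | additiveClosure T X} := by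
  refine ⟨{
    le := {X | WeightLE T 0 X}
    ge := {X | WeightGE T 0 X}
    le_iso_closed := fun e hX => WeightLE.of_iso hX e
    ge_iso_closed := fun e hX => WeightGE.of_iso hX e
    le_summand := fun i r hir hX => WeightLE.of_retract hX i r hir
    ge_summand := fun i r hir hX => WeightGE.of_retract hX i r hir
    le_shift := fun X hX => (WeightLE.shift hX 1 (-1) rfl).mono (by omega)
    ge_shift := fun X hX => (WeightGE.shift hX (-1) 1 rfl).anti (by omega)
    hom_zero := fun {X Y} hX hY => hX Y (WeightLE.of_shift (-1) 0 hY rfl)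
    exists_triangle := fun X => ?_ }, fun X => ?_, ?_⟩
  · obtain ⟨A, B, f, g, h, H, hA, hB⟩ := HasWeightDecomposition.of_triangulatedClosure hneg (hgen X)
    exact ⟨A, B, f, g, h, H, hA.weightGE, hB⟩
  · obtain ⟨a, b, ha, hb⟩ := exists_weightLE_and_weightGE hneg (hgen X)
    exact ⟨⟨a, ha.shift a 0 (by omega)⟩, ⟨b, hb.shift b 0 (by omega)⟩⟩
  · ext X
    exact ⟨fun hX => (HasWeightDecomposition.of_triangulatedClosure hneg
        (hgen _)).additiveClosure_of_weightLE_of_weightGE hX.1 hX.2,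
      fun hX => ⟨hX.weightLE_zero hneg, hX.weightGE_zero⟩⟩
end

section
/- Let M = (V, ρ) be a nilpotent representation of the cyclic quiver Q on n vertices over a field, with socle soc(M) = ker ρ (the Z/n-graded subspace ⊕_i ker ρ_i) and radical filtration rad^k(M) (the graded subrepresentation spanned by all images of k-fold compositions of the maps ρ). Let P be the group of Z/n-graded linear automorphisms of soc(M) preserving the subspace soc(M) ∩ rad^k(M) for every k ≥ 0, and let Aut(M) be the group of Z/n-graded linear automorphisms g of V satisfying g ∘ ρ_i = ρ_i ∘ g for all i. Then every g ∈ Aut(M) restricts to an element of P, and the resulting restriction map Res : Aut(M) → P is surjective (it admits a section θ : P → Aut(M)). -/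
/-!
STATEMENT 8: For a nilpotent representation `M = (V, ρ)` of the cyclic quiver,
every automorphism of `M` restricts to a graded automorphism of the socle
`soc(M) = ker ρ` preserving the subspaces `soc(M) ∩ rad^k(M)`, and the
resulting restriction map `Res : Aut(M) → P` is surjective.
-/

open Module

/-- transport along an equality of vertices -/
def vcast (k : Type*) [Field k] {n : ℕ} {V : ZMod n → Type*}
    [∀ i, AddCommGroup (V i)] [∀ i, Module k (V i)]
    {i j : ZMod n} (h : i = j) : V i →ₗ[k] V j := by
  subst h; exact LinearMap.id

/-- the composition of `m` consecutive structure maps `V_i → V_{i+m}` -/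
def rhoPow {k : Type*} [Field k] {n : ℕ} {V : ZMod n → Type*}
    [∀ i, AddCommGroup (V i)] [∀ i, Module k (V i)]
    (ρ : ∀ i : ZMod n, V i →ₗ[k] V (i + 1)) :
    (m : ℕ) → (i : ZMod n) → (V i →ₗ[k] V (i + (m : ZMod n)))
  | 0, i => vcast k (by simp)
  | (m + 1), i => vcast k (by push_cast; ring) ∘ₗ ((ρ (i + (m : ZMod n))) ∘ₗ rhoPow ρ m i)

/-- `rad^m(M)` at the vertex `i`: the subspace of `V i` spanned by the images of
all `m`-fold compositions of the structure maps (for the cyclic quiver, these all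
come from the vertex `i - m`). -/
def radPow {k : Type*} [Field k] {n : ℕ} {V : ZMod n → Type*}
    [∀ i, AddCommGroup (V i)] [∀ i, Module k (V i)]
    (ρ : ∀ i : ZMod n, V i →ₗ[k] V (i + 1)) (m : ℕ) (i : ZMod n) :
    Submodule k (V i) :=
  LinearMap.range ((vcast k (by ring)) ∘ₗ rhoPow ρ m (i - (m : ZMod n)))

section FilteredLifting

variable {k U W X : Type*} [Field k] [AddCommGroup U] [Module k U] [AddCommGroup W] [Module k W]
  [AddCommGroup X] [Module k X]

/-- Linear maps prescribed on two disjoint subspaces have a common extension. -/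
theorem LinearMap.exists_eqOn_of_disjoint {A D : Submodule k U} (h : Disjoint A D)
    (g s : U →ₗ[k] W) :
    ∃ f : U →ₗ[k] W, (∀ x ∈ A, f x = g x) ∧ ∀ x ∈ D, f x = s x := by
  obtain ⟨E, hDE, hE⟩ := h.symm.exists_isCompl
  refine ⟨LinearMap.ofIsCompl hE.symm (g.domRestrict A) (s.domRestrict E), fun x hx => ?_,
    fun x hx => ?_⟩
  · exact LinearMap.ofIsCompl_apply_left hE.symm ⟨x, hx⟩
  · exact LinearMap.ofIsCompl_apply_right hE.symm ⟨x, hDE hx⟩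

/-- A pointwise lift of `φ` along `ρ` from a subspace `B` into a subspace `G` can be made linear. -/
theorem LinearMap.exists_lift_of_forall_mem (ρ : W →ₗ[k] X) (φ : U →ₗ[k] X)
    {B : Submodule k U} {G : Submodule k W} (h : ∀ x ∈ B, ∃ w ∈ G, ρ w = φ x) :
    ∃ s : U →ₗ[k] W, ∀ x ∈ B, s x ∈ G ∧ ρ (s x) = φ x := by
  have hφ : ∀ x : B, φ.domRestrict B x ∈ LinearMap.range (ρ.domRestrict G) := by
    rintro ⟨x, hx⟩
    obtain ⟨w, hw, e⟩ := h x hx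
    exact ⟨⟨w, hw⟩, e⟩
  obtain ⟨r, hr⟩ := (ρ.domRestrict G).rangeRestrict.exists_rightInverse_of_surjective
    (LinearMap.range_rangeRestrict _)
  obtain ⟨s, hs⟩ := LinearMap.exists_extend
    (G.subtype ∘ₗ r ∘ₗ (φ.domRestrict B).codRestrict _ hφ)
  refine ⟨s, fun x hx => ?_⟩
  have e : s x = r ((φ.domRestrict B).codRestrict _ hφ ⟨x, hx⟩) :=
    LinearMap.congr_fun hs ⟨x, hx⟩
  rw [e]
  exact ⟨Subtype.property _, congrArg Subtype.val (LinearMap.congr_fun hr _)⟩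

/-- Let `ρ` and `φ` have common codomain. If every element of `F m` can be lifted along `ρ` into
`G m`, then a filtration preserving lift `f` on a subspace `K` extends to a filtration
preserving lift on `K ⊔ F 0`. -/
theorem LinearMap.exists_filtered_lift (ρ : W →ₗ[k] X) (φ : U →ₗ[k] X) (K : Submodule k U)
    {F : ℕ → Submodule k U} {G : ℕ → Submodule k W} (hF : Antitone F) (hG : Antitone G)
    {N : ℕ} (hN : F N = ⊥) (hlift : ∀ m, ∀ x ∈ F m, ∃ w ∈ G m, ρ w = φ x)
    (f : U →ₗ[k] W) (hf : ∀ x ∈ K, ρ (f x) = φ x) (hfG : ∀ m, ∀ x ∈ K, x ∈ F m → f x ∈ G m) :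
    ∃ g : U →ₗ[k] W, (∀ x ∈ K, g x = f x) ∧ (∀ x ∈ K ⊔ F 0, ρ (g x) = φ x) ∧
      ∀ m, ∀ x ∈ K ⊔ F 0, x ∈ F m → g x ∈ G m := by
  refine Nat.decreasingInduction (n := N) (m := 0)
    (motive := fun m _ => ∃ g : U →ₗ[k] W, (∀ x ∈ K, g x = f x) ∧
      (∀ x ∈ K ⊔ F m, ρ (g x) = φ x) ∧ ∀ l, ∀ x ∈ K ⊔ F m, x ∈ F l → g x ∈ G l)
    ?_ ⟨f, fun _ _ => rfl, by simpa [hN] using hf, by simpa [hN] using hfG⟩ (Nat.zero_le N)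
  rintro m - ⟨g, hgf, hg, hgG⟩
  set A := K ⊔ F (m + 1)
  obtain ⟨s, hs⟩ := LinearMap.exists_lift_of_forall_mem ρ φ (hlift m)
  obtain ⟨C, hC⟩ := exists_isCompl (A ⊓ F m)
  have hdisj : Disjoint A (F m ⊓ C) := by
    rw [disjoint_iff, ← inf_assoc]
    exact hC.inf_eq_bot
  have hsup : K ⊔ F m ≤ A ⊔ (F m ⊓ C) := by
    refine sup_le (le_sup_left.trans le_sup_left) ?_
    calc F m = (A ⊓ F m ⊔ C) ⊓ F m := by rw [hC.sup_eq_top, top_inf_eq]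
      _ = A ⊓ F m ⊔ C ⊓ F m := sup_inf_assoc_of_le C inf_le_right
      _ ≤ A ⊔ (F m ⊓ C) := sup_le_sup inf_le_left (by rw [inf_comm])
  obtain ⟨g', hg'A, hg'D⟩ := LinearMap.exists_eqOn_of_disjoint hdisj g s
  refine ⟨g', fun x hx => (hg'A x (le_sup_left (b := F (m + 1)) hx)).trans (hgf x hx),
    fun x hx => ?_, fun l x hx hxl => ?_⟩
  · obtain ⟨a, ha, d, hd, rfl⟩ := Submodule.mem_sup.1 (hsup hx)
    rw [map_add, map_add, map_add, hg'A a ha, hg'D d hd, hg a ha, (hs d hd.1).2]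
  · rcases le_or_gt l m with hl | hl
    · obtain ⟨a, ha, d, hd, rfl⟩ := Submodule.mem_sup.1 (hsup hx)
      have hal : a ∈ F l := by
        simpa using (F l).sub_mem hxl (hF hl hd.1)
      rw [map_add, hg'A a ha, hg'D d hd]
      exact (G l).add_mem (hgG l a ha hal) (hG hl (hs d hd.1).1)
    · have hxA : x ∈ A := le_sup_right (a := K) (hF hl hxl)
      rw [hg'A x hxA]
      exact hgG l x hxA hxl

end FilteredLifting

section CyclicQuiver

variable {k : Type*} [Field k] {n : ℕ} {V : ZMod n → Type*}
  [∀ i, AddCommGroup (V i)] [∀ i, Module k (V i)] (ρ : ∀ i : ZMod n, V i →ₗ[k] V (i + 1))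

@[simp]
theorem vcast_self {i : ZMod n} (h : i = i) (x : V i) : vcast k h x = x := rfl

@[simp]
theorem vcast_vcast {i j l : ZMod n} (h : i = j) (h' : j = l) (x : V i) :
    vcast k h' (vcast k h x) = vcast k (h.trans h') x := by
  subst h h'; rfl

theorem mem_radPow_iff {m : ℕ} {i : ZMod n} {x : V i} :
    x ∈ radPow ρ m i ↔
      ∃ (j : ZMod n) (h : j + (m : ZMod n) = i) (y : V j), vcast k h (rhoPow ρ m j y) = x := by
  constructor
  · rintro ⟨y, rfl⟩
    exact ⟨_, _, y, rfl⟩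
  · rintro ⟨j, h, y, rfl⟩
    obtain rfl : j = i - m := eq_sub_of_add_eq h
    exact ⟨y, rfl⟩

theorem radPow_zero (i : ZMod n) : radPow ρ 0 i = ⊤ := by
  refine eq_top_iff.2 fun x _ => (mem_radPow_iff ρ).2 ⟨i, by simp, x, ?_⟩
  simp [rhoPow]

theorem mem_radPow_succ {m : ℕ} {i : ZMod n} {x : V (i + 1)} :
    x ∈ radPow ρ (m + 1) (i + 1) ↔ ∃ y ∈ radPow ρ m i, ρ i y = x := by
  constructor
  · intro hx
    obtain ⟨j, h, y, rfl⟩ := (mem_radPow_iff ρ).1 hx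
    obtain rfl : j + (m : ZMod n) = i := by
      push_cast at h
      rw [← add_assoc] at h
      exact add_right_cancel h
    exact ⟨rhoPow ρ m j y, (mem_radPow_iff ρ).2 ⟨j, rfl, y, rfl⟩, by simp [rhoPow]⟩
  · rintro ⟨z, hz, rfl⟩
    obtain ⟨j, rfl, y, rfl⟩ := (mem_radPow_iff ρ).1 hz
    exact (mem_radPow_iff ρ).2 ⟨j, by push_cast; ring, y, by simp [rhoPow]⟩

theorem radPow_antitone (i : ZMod n) : Antitone fun m => radPow ρ m i := by
  refine antitone_nat_of_succ_le fun m => ?_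
  induction m generalizing i with
  | zero => simp [radPow_zero]
  | succ m ih =>
    obtain ⟨i, rfl⟩ : ∃ j, i = j + 1 := ⟨i - 1, by ring⟩
    intro x hx
    obtain ⟨y, hy, rfl⟩ := (mem_radPow_succ ρ).1 hx
    exact (mem_radPow_succ ρ).2 ⟨y, ih i hy, rfl⟩

theorem radPow_eq_bot {N : ℕ} (hN : ∀ i, rhoPow ρ N i = 0) (i : ZMod n) : radPow ρ N i = ⊥ := by
  simp [radPow, hN]

theorem apply_mem_radPow {g : ∀ i : ZMod n, V i →ₗ[k] V i}
    (hg : ∀ (i : ZMod n) (x : V i), g (i + 1) (ρ i x) = ρ i (g i x)) (m : ℕ) (i : ZMod n)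
    {x : V i} (hx : x ∈ radPow ρ m i) : g i x ∈ radPow ρ m i := by
  induction m generalizing i with
  | zero => simp [radPow_zero]
  | succ m ih =>
    obtain ⟨i, rfl⟩ : ∃ j, i = j + 1 := ⟨i - 1, by ring⟩
    obtain ⟨y, hy, rfl⟩ := (mem_radPow_succ ρ).1 hx
    exact (mem_radPow_succ ρ).2 ⟨g i y, ih i hy, (hg i y).symm⟩

/-- The socle filtration: the subspace of `V i` killed by all `m`-fold compositions of the
structure maps. -/
def socPow : ℕ → (i : ZMod n) → Submodule k (V i)
  | 0, _ => ⊥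
  | m + 1, i => (socPow m (i + 1)).comap (ρ i)

theorem socPow_le_succ (m : ℕ) (i : ZMod n) : socPow ρ m i ≤ socPow ρ (m + 1) i := by
  induction m generalizing i with
  | zero => exact bot_le
  | succ m ih => exact Submodule.comap_mono (ih (i + 1))

theorem radPow_le_socPow {N : ℕ} (hN : ∀ i, rhoPow ρ N i = 0) {m j : ℕ} (h : m + j = N)
    (i : ZMod n) : radPow ρ m i ≤ socPow ρ j i := by
  induction j generalizing m i with
  | zero =>
    subst h
    exact (radPow_eq_bot ρ hN i).le
  | succ j ih =>
    intro x hx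
    exact ih (m := m + 1) (by omega) (i + 1) ((mem_radPow_succ ρ).2 ⟨x, hx, rfl⟩)

theorem socPow_eq_top {N : ℕ} (hN : ∀ i, rhoPow ρ N i = 0) (i : ZMod n) : socPow ρ N i = ⊤ :=
  top_le_iff.1 ((radPow_zero ρ i).ge.trans (radPow_le_socPow ρ hN (zero_add N) i))

/-- A graded map on the `j`-th socle layer which commutes with `ρ` and respects the radical
filtration extends to the next socle layer. -/
theorem exists_extend_socPow_succ {N : ℕ} (hN : ∀ i, rhoPow ρ N i = 0) (j : ℕ)
    (f : ∀ i : ZMod n, V i →ₗ[k] V i)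
    (hf : ∀ i, ∀ x ∈ socPow ρ j i, f (i + 1) (ρ i x) = ρ i (f i x))
    (hrad : ∀ m i, ∀ x ∈ socPow ρ j i, x ∈ radPow ρ m i → f i x ∈ radPow ρ m i) :
    ∃ g : ∀ i : ZMod n, V i →ₗ[k] V i, (∀ i, ∀ x ∈ socPow ρ j i, g i x = f i x) ∧
      (∀ i, ∀ x ∈ socPow ρ (j + 1) i, g (i + 1) (ρ i x) = ρ i (g i x)) ∧
      ∀ m i, ∀ x ∈ socPow ρ (j + 1) i, x ∈ radPow ρ m i → g i x ∈ radPow ρ m i := by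
  have key (i : ZMod n) := LinearMap.exists_filtered_lift (ρ i) (f (i + 1) ∘ₗ ρ i) (socPow ρ j i)
    (F := fun m => socPow ρ (j + 1) i ⊓ radPow ρ m i) (G := fun m => radPow ρ m i)
    (fun _ _ h => inf_le_inf_left _ (radPow_antitone ρ i h)) (radPow_antitone ρ i)
    (N := N) (by simp [radPow_eq_bot ρ hN])
    (fun m x hx => (mem_radPow_succ ρ).1
      (hrad (m + 1) (i + 1) (ρ i x) hx.1 ((mem_radPow_succ ρ).2 ⟨x, hx.2, rfl⟩)))
    (f i) (fun x hx => (hf i x hx).symm) (fun m x hx hxm => hrad m i x hx hxm.2)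
  have hsup (i : ZMod n) : socPow ρ (j + 1) i ≤
      socPow ρ j i ⊔ socPow ρ (j + 1) i ⊓ radPow ρ 0 i := by
    simp [radPow_zero]
  choose g hgf hg hgrad using key
  refine ⟨g, hgf, fun i x hx => ?_, fun m i x hx hxm => hgrad i m x (hsup i hx) ⟨hx, hxm⟩⟩
  rw [hg i x (hsup i hx), hgf (i + 1) (ρ i x) hx]
  rfl

/-- A graded map on the socle which respects the radical filtration extends to an endomorphism. -/
theorem exists_extend_ker {N : ℕ} (hN : ∀ i, rhoPow ρ N i = 0)
    (p : ∀ i : ZMod n, LinearMap.ker (ρ i) →ₗ[k] LinearMap.ker (ρ i))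
    (hp : ∀ (m : ℕ) (i : ZMod n) (x : LinearMap.ker (ρ i)),
      (x : V i) ∈ radPow ρ m i → (p i x : V i) ∈ radPow ρ m i) :
    ∃ g : ∀ i : ZMod n, V i →ₗ[k] V i,
      (∀ (i : ZMod n) (x : V i), g (i + 1) (ρ i x) = ρ i (g i x)) ∧
      ∀ (i : ZMod n) (x : LinearMap.ker (ρ i)), g i (x : V i) = (p i x : V i) := by
  have key (j : ℕ) : ∃ g : ∀ i : ZMod n, V i →ₗ[k] V i,
      (∀ (i : ZMod n) (x : LinearMap.ker (ρ i)), g i (x : V i) = (p i x : V i)) ∧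
      (∀ i, ∀ x ∈ socPow ρ (j + 1) i, g (i + 1) (ρ i x) = ρ i (g i x)) ∧
      ∀ m i, ∀ x ∈ socPow ρ (j + 1) i, x ∈ radPow ρ m i → g i x ∈ radPow ρ m i := by
    induction j with
    | zero =>
      choose f hf using fun i => LinearMap.exists_extend ((LinearMap.ker (ρ i)).subtype ∘ₗ p i)
      have hfp (i : ZMod n) (x : LinearMap.ker (ρ i)) : f i (x : V i) = (p i x : V i) :=
        LinearMap.congr_fun (hf i) x
      refine ⟨f, hfp, fun i x hx => ?_, fun m i x hx hxm => ?_⟩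
      · have hx' : ρ i x = 0 := hx
        rw [hfp i ⟨x, hx⟩, hx', map_zero]
        exact (p i ⟨x, hx⟩).2.symm
      · rw [hfp i ⟨x, hx⟩]
        exact hp m i ⟨x, hx⟩ hxm
    | succ j ih =>
      obtain ⟨f, hfp, hf, hrad⟩ := ih
      obtain ⟨g, hgf, hg⟩ := exists_extend_socPow_succ ρ hN (j + 1) f hf hrad
      refine ⟨g, fun i x => ?_, hg⟩
      rw [hgf i x, hfp]
      exact monotone_nat_of_le_succ (fun m => socPow_le_succ ρ m i) (Nat.le_add_left 1 j) x.2
  obtain ⟨g, hgp, hg, -⟩ := key N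
  refine ⟨g, fun i x => hg i x (socPow_le_succ ρ N i ?_), hgp⟩
  simp [socPow_eq_top ρ hN]

/-- An endomorphism of a nilpotent representation which is injective on the socle is injective. -/
theorem injective_of_injective_on_ker {N : ℕ} (hN : ∀ i, rhoPow ρ N i = 0)
    {g : ∀ i : ZMod n, V i →ₗ[k] V i}
    (hg : ∀ (i : ZMod n) (x : V i), g (i + 1) (ρ i x) = ρ i (g i x))
    (hker : ∀ i, ∀ x ∈ LinearMap.ker (ρ i), g i x = 0 → x = 0) (i : ZMod n) :
    Function.Injective (g i) := by
  have key (j : ℕ) : ∀ i, ∀ x ∈ socPow ρ j i, g i x = 0 → x = 0 := by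
    induction j with
    | zero => exact fun i x hx _ => hx
    | succ j ih =>
      intro i x hx hgx
      exact hker i x (ih (i + 1) (ρ i x) hx (by rw [hg, hgx, map_zero])) hgx
  refine (injective_iff_map_eq_zero _).2 fun x => key N i x ?_
  simp [socPow_eq_top ρ hN]

end CyclicQuiver

/-- For a nilpotent representation of the cyclic quiver:
(1) every automorphism `g` of `M` restricts to an automorphism of the socle
`soc(M) = ker ρ` preserving `soc(M) ∩ rad^m(M)` for all `m ≥ 0`, i.e. `Res`
takes values in `P`;
(2) `Res : Aut(M) → P` is surjective, i.e. every graded automorphism of the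
socle preserving all `soc(M) ∩ rad^m(M)` lifts to an automorphism of `M`. -/
theorem socle_automorphism_lifts
    {k : Type*} [Field k] {n : ℕ}
    {V : ZMod n → Type*} [∀ i, AddCommGroup (V i)] [∀ i, Module k (V i)]
    [∀ i, FiniteDimensional k (V i)]
    (ρ : ∀ i : ZMod n, V i →ₗ[k] V (i + 1))
    (hnil : ∃ m : ℕ, ∀ i : ZMod n, rhoPow ρ m i = 0) :
    -- (1) restriction is well defined and lands in P
    (∀ (g : ∀ i : ZMod n, V i ≃ₗ[k] V i),
      (∀ (i : ZMod n) (x : V i), g (i + 1) (ρ i x) = ρ i (g i x)) →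
      (∀ (i : ZMod n) (x : V i), x ∈ LinearMap.ker (ρ i) → g i x ∈ LinearMap.ker (ρ i)) ∧
      (∀ (m : ℕ) (i : ZMod n) (x : V i),
        x ∈ LinearMap.ker (ρ i) ⊓ radPow ρ m i → g i x ∈ LinearMap.ker (ρ i) ⊓ radPow ρ m i)) ∧
    -- (2) Res : Aut(M) → P is surjective: every element of P lifts
    (∀ (p : ∀ i : ZMod n, LinearMap.ker (ρ i) ≃ₗ[k] LinearMap.ker (ρ i)),
      (∀ (m : ℕ) (i : ZMod n) (x : LinearMap.ker (ρ i)),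
        (x : V i) ∈ radPow ρ m i → (p i x : V i) ∈ radPow ρ m i) →
      ∃ g : ∀ i : ZMod n, V i ≃ₗ[k] V i,
        (∀ (i : ZMod n) (x : V i), g (i + 1) (ρ i x) = ρ i (g i x)) ∧
        (∀ (i : ZMod n) (x : LinearMap.ker (ρ i)), g i (x : V i) = (p i x : V i))) := by
  obtain ⟨N, hN⟩ := hnil
  refine ⟨fun g hg => ?_, fun p hp => ?_⟩
  · have hker (i : ZMod n) (x : V i) (hx : x ∈ LinearMap.ker (ρ i)) :
        g i x ∈ LinearMap.ker (ρ i) := by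
      rw [LinearMap.mem_ker] at hx ⊢
      rw [← hg, hx, map_zero]
    exact ⟨hker, fun m i x hx =>
      ⟨hker i x hx.1, apply_mem_radPow ρ (g := fun i => (g i).toLinearMap) hg m i hx.2⟩⟩
  · obtain ⟨g, hg, hgp⟩ := exists_extend_ker ρ hN (fun i => (p i).toLinearMap) hp
    have hinj := injective_of_injective_on_ker ρ hN hg fun i x hx hgx => by
      have h0 : p i ⟨x, hx⟩ = 0 := Subtype.ext ((hgp i ⟨x, hx⟩).symm.trans hgx)
      exact congrArg Subtype.val ((p i).map_eq_zero_iff.1 h0)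
    exact ⟨fun i => LinearEquiv.ofInjectiveEndo (g i) (hinj i), hg, hgp⟩
end
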